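/- Let I be a countable index set with at least 2 elements and let (H_i)_{i ∈ I} be a family of countable nontrivial groups such that at least one H_j has at least 3 elements. Then there exists a group S that is simple and generated by 2 elements, together with injective group homomorphisms φ_i : H_i → S for every i ∈ I, such that for all i, j ∈ I with i ≠ j and |H_j| ≥ 3, the group S is generated by the union of the images φ_i(H_i) and φ_j(H_j). -/

import Mathlib

namespace EmbSimple
open Equiv
open scoped commutatorElement

theorem app_inv {α : Type*} (g : Perm α) (x : α) : g (g⁻¹ x) = x := Equiv.apply_symm_apply g x

theorem inv_app {α : Type*} (g : Perm α) (x : α) : g⁻¹ (g x) = x := Equiv.symm_apply_apply g x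


/-- The countable set of points on which all groups act. -/
def Pt : Type := ℕ

/-- Prepend a natural number label to a point. -/
def cons (n : ℕ) (w : Pt) : Pt := Nat.pair n w

theorem cons_inj {n m : ℕ} {w w' : Pt} : cons n w = cons m w' ↔ n = m ∧ w = w' :=
  Nat.pair_eq_pair

theorem cons_surj (x : Pt) : ∃ n w, x = cons n w :=
  ⟨(Nat.unpair x).1, (Nat.unpair x).2, (Nat.pair_unpair x).symm⟩

/-- The bijection between points and pairs of a label and a point. -/
def splitEquiv : Pt ≃ ℕ × Pt := (Nat.pairEquiv).symm

theorem splitEquiv_symm (n : ℕ) (w : Pt) : splitEquiv.symm (n, w) = cons n w := rfl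

theorem splitEquiv_cons (n : ℕ) (w : Pt) : splitEquiv (cons n w) = (n, w) := by
  rw [← splitEquiv_symm, Equiv.apply_symm_apply]

/-- Prepend a binary letter to a point. -/
def bit : Bool → Pt → Pt
  | true, w => cons 0 w
  | false, w => cons ((splitEquiv w).1 + 1) (splitEquiv w).2

theorem bit_true (w : Pt) : bit true w = cons 0 w := rfl

theorem bit_false_cons (n : ℕ) (w : Pt) : bit false (cons n w) = cons (n + 1) w := by
  simp [bit, splitEquiv_cons]

theorem bit_inj {x y : Bool} {w w' : Pt} : bit x w = bit y w' ↔ x = y ∧ w = w' := by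
  obtain ⟨n, v, rfl⟩ := cons_surj w
  obtain ⟨m, v', rfl⟩ := cons_surj w'
  cases x <;> cases y <;> simp [bit_true, bit_false_cons, cons_inj]

theorem bit_surj (x : Pt) : ∃ b w, x = bit b w := by
  obtain ⟨n, v, rfl⟩ := cons_surj x
  cases n with
  | zero => exact ⟨true, v, rfl⟩
  | succ n => exact ⟨false, cons n v, (bit_false_cons n v).symm⟩

/-- Prepend a finite binary word to a point. -/
def cat (c : List Bool) (w : Pt) : Pt := c.foldr bit w

@[simp] theorem cat_nil (w : Pt) : cat [] w = w := rfl
theorem cat_cons (b : Bool) (c : List Bool) (w : Pt) : cat (b :: c) w = bit b (cat c w) := rfl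
theorem cat_append (c d : List Bool) (w : Pt) : cat (c ++ d) w = cat c (cat d w) := by
  simp [cat]

theorem cat_inj {c : List Bool} {w w' : Pt} : cat c w = cat c w' ↔ w = w' := by
  induction c with
  | nil => rfl
  | cons b c ih => simp [cat_cons, bit_inj, ih]

theorem cat_injective (c : List Bool) : Function.Injective (cat c) := fun _ _ => cat_inj.1

/-- The binary word of a natural number label. -/
def num (n : ℕ) : List Bool := List.replicate n false ++ [true]

theorem num_zero : num 0 = [true] := rfl
theorem num_succ (n : ℕ) : num (n + 1) = false :: num n := rfl
theorem cat_num (n : ℕ) (w : Pt) : cat (num n) w = cons n w := by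
  induction n with
  | zero => rfl
  | succ n ih => rw [num_succ, cat_cons, ih, bit_false_cons]

/-- Incomparability of binary words. -/
def inc : List Bool → List Bool → Prop
  | x :: a, y :: b => x ≠ y ∨ inc a b
  | _, _ => False

@[simp] theorem inc_nil_left (a : List Bool) : ¬ inc [] a := by simp [inc]
@[simp] theorem inc_nil_right (a : List Bool) : ¬ inc a [] := by cases a <;> simp [inc]
@[simp] theorem inc_cons {x y : Bool} {a b : List Bool} :
    inc (x :: a) (y :: b) ↔ x ≠ y ∨ inc a b := Iff.rfl

theorem inc_self (a : List Bool) : ¬ inc a a := by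
  induction a <;> simp_all

theorem inc_comm {a b : List Bool} : inc a b ↔ inc b a := by
  induction a generalizing b with
  | nil => simp
  | cons x a ih => cases b <;> simp [ih, eq_comm]

theorem inc.symm {a b : List Bool} (h : inc a b) : inc b a := inc_comm.1 h

@[simp] theorem inc_append_left (p : List Bool) {a b : List Bool} :
    inc (p ++ a) (p ++ b) ↔ inc a b := by
  induction p <;> simp_all

theorem inc.append_right {a b : List Bool} (h : inc a b) (c d : List Bool) :
    inc (a ++ c) (b ++ d) := by
  induction a generalizing b with
  | nil => simp at h
  | cons x a ih =>
    cases b with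
    | nil => simp at h
    | cons y b =>
      rcases inc_cons.1 h with h | h
      · simp [h]
      · simp [ih h]

theorem inc.right {a b : List Bool} (h : inc a b) (d : List Bool) : inc a (b ++ d) := by
  simpa using h.append_right [] d

theorem inc.left {a b : List Bool} (h : inc a b) (d : List Bool) : inc (a ++ d) b := by
  simpa using h.append_right d []

theorem inc_num {n m : ℕ} (h : n ≠ m) : inc (num n) (num m) := by
  induction n generalizing m with
  | zero => cases m with
    | zero => exact absurd rfl h
    | succ m => simp [num_succ, num_zero]
  | succ n ih => cases m with
    | zero => simp [num_succ, num_zero]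
    | succ m => simpa [num_succ] using ih (by omega)

theorem cat_ne {a b : List Bool} (h : inc a b) (w w' : Pt) : cat a w ≠ cat b w' := by
  induction a generalizing b with
  | nil => simp at h
  | cons x a ih =>
    cases b with
    | nil => simp at h
    | cons y b =>
      rw [cat_cons, cat_cons, Ne, bit_inj]
      rcases inc_cons.1 h with h | h
      · simp [h]
      · simp [ih h]

theorem prefix_of_not_inc {a b : List Bool} (h : ¬ inc a b) :
    (∃ c, b = a ++ c) ∨ (∃ c, a = b ++ c) := by
  induction a generalizing b with
  | nil => exact Or.inl ⟨b, rfl⟩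
  | cons x a ih =>
    cases b with
    | nil => exact Or.inr ⟨x :: a, rfl⟩
    | cons y b =>
      simp only [inc_cons, not_or, not_not] at h
      obtain ⟨rfl, h⟩ := h
      rcases ih h with ⟨c, rfl⟩ | ⟨c, rfl⟩
      · exact Or.inl ⟨c, rfl⟩
      · exact Or.inr ⟨c, rfl⟩

/-- The cone of points beginning with a given word. -/
def Cone (c : List Bool) : Set Pt := Set.range (cat c)

theorem mem_cone (c : List Bool) (w : Pt) : cat c w ∈ Cone c := ⟨w, rfl⟩

theorem notMem_cone {a b : List Bool} (h : inc a b) (w : Pt) : cat a w ∉ Cone b := by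
  rintro ⟨w', h'⟩
  exact cat_ne h _ _ h'.symm

theorem mem_cone_append {c d : List Bool} {x : Pt} (h : x ∈ Cone (c ++ d)) : x ∈ Cone c := by
  obtain ⟨w, rfl⟩ := h
  rw [cat_append]
  exact mem_cone _ _

/-- The homomorphism letting a permutation act inside a cone. -/
noncomputable def Cn (c : List Bool) : Perm Pt →* Perm Pt :=
  Perm.viaEmbeddingHom ⟨cat c, cat_injective c⟩

@[simp] theorem Cn_cat (c : List Bool) (g : Perm Pt) (w : Pt) :
    Cn c g (cat c w) = cat c (g w) :=
  Perm.viaEmbedding_apply g ⟨cat c, cat_injective c⟩ w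

theorem Cn_fix {c : List Bool} (g : Perm Pt) {x : Pt} (h : x ∉ Cone c) : Cn c g x = x :=
  Perm.viaEmbedding_apply_of_notMem g ⟨cat c, cat_injective c⟩ x h

theorem Cn_fix_cat {c d : List Bool} (h : inc d c) (g : Perm Pt) (w : Pt) :
    Cn c g (cat d w) = cat d w := Cn_fix g (notMem_cone h w)

theorem eq_Cn_of {c : List Bool} {g m : Perm Pt} (h1 : ∀ w, g (cat c w) = cat c (m w))
    (h2 : ∀ x, x ∉ Cone c → g x = x) : g = Cn c m := by
  ext x
  by_cases hx : x ∈ Cone c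
  · obtain ⟨w, rfl⟩ := hx
    rw [h1, Cn_cat]
  · rw [h2 x hx, Cn_fix m hx]

theorem Cn_Cn (c d : List Bool) (g : Perm Pt) : Cn c (Cn d g) = Cn (c ++ d) g := by
  refine (eq_Cn_of ?_ ?_).symm
  · intro w
    by_cases hw : w ∈ Cone d
    · obtain ⟨w, rfl⟩ := hw
      rw [← cat_append, Cn_cat, Cn_cat, cat_append]
    · rw [Cn_fix _ hw, Cn_fix]
      rintro ⟨v, hv⟩
      rw [cat_append, cat_inj] at hv
      exact hw ⟨v, hv⟩
  · intro x hx
    exact Cn_fix _ (fun h => hx (mem_cone_append h))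

theorem exists_eq_Cn {c : List Bool} {g : Perm Pt} (h : ∀ x, x ∉ Cone c → g x = x) :
    ∃ m, g = Cn c m := by
  have key : ∀ g : Perm Pt, (∀ x, x ∉ Cone c → g x = x) → ∀ w, ∃ v, g (cat c w) = cat c v := by
    intro g h w
    by_contra hv
    have : g (cat c w) ∉ Cone c := fun ⟨v, hv'⟩ => hv ⟨v, hv'.symm⟩
    have := g.injective (h _ this)
    exact hv ⟨w, this⟩
  have h' : ∀ x, x ∉ Cone c → g⁻¹ x = x := fun x hx => by
    rw [Perm.inv_eq_iff_eq, h x hx]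
  choose f hf using key g h
  choose f' hf' using key g⁻¹ h'
  refine ⟨⟨f, f', fun w => ?_, fun w => ?_⟩, eq_Cn_of hf h⟩
  · rw [← @cat_inj c, ← hf', ← hf]; simp
  · rw [← @cat_inj c, ← hf, ← hf']; simp

theorem Cn_mul_comm {c d : List Bool} (h : inc c d) (g g' : Perm Pt) :
    Commute (Cn c g) (Cn d g') := by
  ext x
  simp only [Perm.mul_apply]
  by_cases hc : x ∈ Cone c
  · obtain ⟨w, rfl⟩ := hc
    rw [Cn_fix_cat h, Cn_cat, Cn_fix_cat h]
  · by_cases hd : x ∈ Cone d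
    · obtain ⟨w, rfl⟩ := hd
      rw [Cn_cat, Cn_fix_cat h.symm, Cn_fix_cat h.symm, Cn_cat]
    · rw [Cn_fix _ hc, Cn_fix _ hd, Cn_fix _ hc]

theorem conj_Cn {c d : List Bool} {v : Perm Pt} (h : ∀ w, v (cat c w) = cat d w)
    (g : Perm Pt) : v * Cn c g * v⁻¹ = Cn d g := by
  apply eq_Cn_of
  · intro w
    have : v⁻¹ (cat d w) = cat c w := by rw [Perm.inv_eq_iff_eq, h]
    simp only [Perm.mul_apply, this, h, Cn_cat]
  · intro x hx
    have : v⁻¹ x ∉ Cone c := by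
      rintro ⟨w, hw⟩
      apply hx
      rw [Perm.eq_inv_iff_eq, h] at hw
      exact ⟨w, hw⟩
    rw [Perm.mul_apply, Perm.mul_apply, Cn_fix _ this, app_inv]

/-- The permutation acting by `k n` on the points with first label `n`. -/
def Th : (ℕ → Perm Pt) →* Perm Pt where
  toFun k := splitEquiv.symm.permCongr (Equiv.prodShear (Equiv.refl ℕ) k)
  map_one' := by
    ext x
    obtain ⟨n, w, rfl⟩ := cons_surj x
    simp [splitEquiv_cons, splitEquiv_symm]
  map_mul' f g := by
    ext x
    obtain ⟨n, w, rfl⟩ := cons_surj x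
    simp [splitEquiv_cons, splitEquiv_symm]

@[simp] theorem Th_cons (k : ℕ → Perm Pt) (n : ℕ) (w : Pt) : Th k (cons n w) = cons n (k n w) := by
  simp [Th, splitEquiv_cons, splitEquiv_symm]

/-- The action of permutations of labels. -/
def io : Perm ℕ →* Perm Pt where
  toFun k := splitEquiv.symm.permCongr (k.prodCongr (Equiv.refl Pt))
  map_one' := by
    ext x
    obtain ⟨n, w, rfl⟩ := cons_surj x
    simp [splitEquiv_cons, splitEquiv_symm]
  map_mul' f g := by
    ext x
    obtain ⟨n, w, rfl⟩ := cons_surj x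
    simp [splitEquiv_cons, splitEquiv_symm]

@[simp] theorem io_cons (k : Perm ℕ) (n : ℕ) (w : Pt) : io k (cons n w) = cons (k n) w := by
  simp [io, splitEquiv_cons, splitEquiv_symm]

theorem io_num (k : Perm ℕ) (n : ℕ) (w : Pt) : io k (cat (num n) w) = cat (num (k n)) w := by
  rw [cat_num, cat_num, io_cons]

open Classical in
/-- The permutation exchanging two cones (trivial if the words are comparable). -/
noncomputable def sw (a b : List Bool) : Perm Pt :=
  if h : inc a b then
    Perm.viaEmbedding (Equiv.prodCongr (Equiv.swap true false) (Equiv.refl Pt))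
      ⟨fun q : Bool × Pt => cat (if q.1 then a else b) q.2, by
        rintro ⟨x, w⟩ ⟨y, w'⟩ hq
        cases x <;> cases y <;> simp [cat_inj] at hq ⊢
        · exact hq
        · exact cat_ne h _ _ hq.symm
        · exact cat_ne h _ _ hq
        · exact hq⟩
  else 1

theorem sw_left {a b : List Bool} (h : inc a b) (w : Pt) : sw a b (cat a w) = cat b w := by
  rw [sw, dif_pos h]
  exact Perm.viaEmbedding_apply (Equiv.prodCongr (Equiv.swap true false) (Equiv.refl Pt))
      ⟨fun q : Bool × Pt => cat (if q.1 then a else b) q.2, _⟩ (true, w)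

theorem sw_right {a b : List Bool} (h : inc a b) (w : Pt) : sw a b (cat b w) = cat a w := by
  rw [sw, dif_pos h]
  exact Perm.viaEmbedding_apply (Equiv.prodCongr (Equiv.swap true false) (Equiv.refl Pt))
      ⟨fun q : Bool × Pt => cat (if q.1 then a else b) q.2, _⟩ (false, w)

theorem sw_fix {a b : List Bool} {x : Pt} (ha : x ∉ Cone a) (hb : x ∉ Cone b) :
    sw a b x = x := by
  rw [sw]
  split_ifs with h
  · apply Perm.viaEmbedding_apply_of_notMem
    rintro ⟨⟨y, w⟩, rfl⟩
    cases y
    · exact hb ⟨w, rfl⟩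
    · exact ha ⟨w, rfl⟩
  · rfl

theorem sw_of_not_inc {a b : List Bool} (h : ¬ inc a b) : sw a b = 1 := by
  rw [sw, dif_neg h]

theorem sw_fix_cat {a b c : List Bool} (ha : inc c a) (hb : inc c b) (w : Pt) :
    sw a b (cat c w) = cat c w := sw_fix (notMem_cone ha w) (notMem_cone hb w)

theorem sw_unique {a b : List Bool} (hab : inc a b) {g : Perm Pt}
    (h1 : ∀ w, g (cat a w) = cat b w) (h2 : ∀ w, g (cat b w) = cat a w)
    (h3 : ∀ x, x ∉ Cone a → x ∉ Cone b → g x = x) : g = sw a b := by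
  ext x
  by_cases ha : x ∈ Cone a
  · obtain ⟨w, rfl⟩ := ha
    rw [h1, sw_left hab]
  · by_cases hb : x ∈ Cone b
    · obtain ⟨w, rfl⟩ := hb
      rw [h2, sw_right hab]
    · rw [h3 x ha hb, sw_fix ha hb]

theorem sw_comm (a b : List Bool) : sw a b = sw b a := by
  by_cases h : inc a b
  · exact sw_unique h.symm (sw_right h) (sw_left h) (fun x h1 h2 => sw_fix h2 h1)
  · rw [sw_of_not_inc h, sw_of_not_inc (fun h' => h h'.symm)]

theorem conj_sw {a b a' b' : List Bool} {g : Perm Pt} (hab : inc a b) (hab' : inc a' b')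
    (ha : ∀ w, g (cat a w) = cat a' w) (hb : ∀ w, g (cat b w) = cat b' w) :
    g * sw a b * g⁻¹ = sw a' b' := by
  have ha' : ∀ w, g⁻¹ (cat a' w) = cat a w := fun w => by rw [Perm.inv_eq_iff_eq, ha]
  have hb' : ∀ w, g⁻¹ (cat b' w) = cat b w := fun w => by rw [Perm.inv_eq_iff_eq, hb]
  apply sw_unique hab'
  · intro w; simp only [Perm.mul_apply, ha', sw_left hab, hb]
  · intro w; simp only [Perm.mul_apply, hb', sw_right hab, ha]
  · intro x hxa hxb
    have h1 : g⁻¹ x ∉ Cone a := by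
      rintro ⟨w, hw⟩
      rw [Perm.eq_inv_iff_eq, ha] at hw
      exact hxa ⟨w, hw⟩
    have h2 : g⁻¹ x ∉ Cone b := by
      rintro ⟨w, hw⟩
      rw [Perm.eq_inv_iff_eq, hb] at hw
      exact hxb ⟨w, hw⟩
    rw [Perm.mul_apply, Perm.mul_apply, sw_fix h1 h2, app_inv]

theorem sw_mul_self (a b : List Bool) : sw a b * sw a b = 1 := by
  by_cases h : inc a b
  · ext x
    by_cases ha : x ∈ Cone a
    · obtain ⟨w, rfl⟩ := ha
      simp [sw_left h, sw_right h]
    · by_cases hb : x ∈ Cone b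
      · obtain ⟨w, rfl⟩ := hb
        simp [sw_left h, sw_right h]
      · simp [sw_fix ha hb]
  · simp [sw_of_not_inc h]

theorem sw_inv (a b : List Bool) : (sw a b)⁻¹ = sw a b :=
  inv_eq_of_mul_eq_one_left (sw_mul_self a b)

theorem sw_split {a b : List Bool} (h : inc a b) :
    sw a b = sw (a ++ [false]) (b ++ [false]) * sw (a ++ [true]) (b ++ [true]) := by
    symm
    have hs : ∀ (x y : Bool), inc (a ++ [x]) (b ++ [y]) := fun x y => h.append_right _ _
    have hft (c : List Bool) : inc (c ++ [false]) (c ++ [true]) := by simp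
    have htf (c : List Bool) : inc (c ++ [true]) (c ++ [false]) := by simp
    apply sw_unique h
    · intro w
      obtain ⟨y, v, rfl⟩ := bit_surj w
      have e : ∀ c : List Bool, cat c (bit y v) = cat (c ++ [y]) v := fun c => by
        rw [cat_append]; rfl
      rw [e, e]
      cases y
      · rw [Perm.mul_apply, sw_fix_cat (hft a) (hs _ _), sw_left (hs _ _)]
      · rw [Perm.mul_apply, sw_left (hs _ _), sw_fix_cat (hs _ _).symm (htf b)]
    · intro w
      obtain ⟨y, v, rfl⟩ := bit_surj w
      have e : ∀ c : List Bool, cat c (bit y v) = cat (c ++ [y]) v := fun c => by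
        rw [cat_append]; rfl
      rw [e, e]
      cases y
      · rw [Perm.mul_apply, sw_fix_cat (hs _ _).symm (hft b), sw_right (hs _ _)]
      · rw [Perm.mul_apply, sw_right (hs _ _), sw_fix_cat (htf a) (hs _ _)]
    · intro x ha hb
      rw [Perm.mul_apply, sw_fix (fun h => ha (mem_cone_append h)) (fun h => hb (mem_cone_append h)),
        sw_fix (fun h => ha (mem_cone_append h)) (fun h => hb (mem_cone_append h))]

theorem sw_eq_commutator {a b : List Bool} (h : inc a b) :
    sw a b = ⁅sw (a ++ [false]) (b ++ [false]),
      sw (a ++ [false]) (a ++ [true]) * sw (b ++ [false]) (b ++ [true])⁆ := by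
  have hs : ∀ (x y : Bool), inc (a ++ [x]) (b ++ [y]) := fun x y => h.append_right _ _
  have hft (c : List Bool) : inc (c ++ [false]) (c ++ [true]) := by simp
  have key := conj_sw (g := sw (a ++ [false]) (a ++ [true]) * sw (b ++ [false]) (b ++ [true]))
    (hs false false) (hs true true)
    (fun w => by rw [Perm.mul_apply, sw_fix_cat (hs _ _) (hs _ _), sw_left (hft a)])
    (fun w => by rw [Perm.mul_apply, sw_left (hft b), sw_fix_cat (hs _ _).symm (hs _ _).symm])
  rw [sw_split h, commutatorElement_def, sw_inv (a ++ [false]) (b ++ [false]), mul_assoc, mul_assoc,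
    ← mul_assoc _ (sw (a ++ [false]) (b ++ [false])), key]

theorem sw_trans {a b e : List Bool} (hab : inc a b) (hae : inc a e) (hbe : inc b e) :
    sw a b = sw a e * sw e b * (sw a e)⁻¹ :=
  (conj_sw hbe.symm hab (sw_right hae) (sw_fix_cat hab.symm hbe)).symm

theorem sw_mem_of_deep (N : Subgroup (Perm Pt)) (m : ℕ)
    (h : ∀ a b, inc a b → m ≤ a.length → m ≤ b.length → sw a b ∈ N) {a b : List Bool}
    (hab : inc a b) : sw a b ∈ N := by
  suffices H : ∀ k a b, inc a b → m ≤ a.length + k → m ≤ b.length + k → sw a b ∈ N from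
    H m a b hab (by omega) (by omega)
  intro k
  induction k with
  | zero => exact h
  | succ k ih =>
    intro a b hab h1 h2
    rw [sw_split hab]
    exact N.mul_mem (ih _ _ (hab.append_right _ _) (by simp; omega) (by simp; omega))
      (ih _ _ (hab.append_right _ _) (by simp; omega) (by simp; omega))

theorem exists_pair_inc {c b : List Bool} (hc : c.length = 3) (hb : b ≠ []) :
    ∃ d, d.length = 2 ∧ inc d c ∧ inc d b := by
  match c, hc with
  | [x, y, z], _ =>
    match b, hb with
    | [u], _ =>
      by_cases h : x = !u
      · exact ⟨[!u, !y], rfl, by simp, by simp⟩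
      · exact ⟨[!u, y], rfl, by simp [Ne.symm h], by simp⟩
    | u :: v :: b, _ =>
      by_cases h : x = u
      · exact ⟨[!x, y], rfl, by simp, by simp [h]⟩
      · exact ⟨[x, !y], rfl, by simp, by simp [h]⟩

theorem sw_mem_of_short (N : Subgroup (Perm Pt))
    (h : ∀ a b, inc a b → a.length ≤ 3 → b.length ≤ 3 → sw a b ∈ N) {a b : List Bool}
    (hab : inc a b) : sw a b ∈ N := by
  suffices H : ∀ k a b, a.length + b.length ≤ k → inc a b → sw a b ∈ N from
    H _ a b le_rfl hab
  intro k
  induction k with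
  | zero =>
    intro a b hk hab
    exact h a b hab (by omega) (by omega)
  | succ k ih =>
    have main : ∀ a b : List Bool, a.length + b.length ≤ k + 1 → inc a b → 3 < a.length →
        sw a b ∈ N := by
      intro a b hk hab ha
      obtain ⟨c, r, rfl, hc⟩ : ∃ c r, a = c ++ r ∧ c.length = 3 :=
        ⟨a.take 3, a.drop 3, (List.take_append_drop 3 a).symm, by simp; omega⟩
      have hb : b ≠ [] := by rintro rfl; simp at hab
      obtain ⟨d, hd, hdc, hdb⟩ := exists_pair_inc hc hb
      have hs : sw c d ∈ N := h c d hdc.symm (by omega) (by omega)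
      have ha' : ∀ w, sw c d (cat (c ++ r) w) = cat (d ++ r) w := fun w => by
        rw [cat_append, sw_left hdc.symm, cat_append]
      have fin : ∀ b', inc (d ++ r) b' → (d ++ r).length + b'.length ≤ k →
          (∀ w, sw c d (cat b w) = cat b' w) → sw (c ++ r) b ∈ N := by
        intro b' hb' hk' hw
        have := ih _ _ hk' hb'
        rw [← conj_sw hab hb' ha' hw] at this
        have := N.mul_mem (N.mul_mem (N.inv_mem hs) this) hs
        simpa [mul_assoc] using this
      rw [List.length_append] at hk
      by_cases hcb : inc c b
      · exact fin b (hdb.left r) (by simp; omega) (sw_fix_cat hcb.symm hdb.symm)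
      · rcases prefix_of_not_inc hcb with ⟨s, rfl⟩ | ⟨s, rfl⟩
        · rw [List.length_append] at hk
          refine fin (d ++ s) (by simpa using hab) (by simp; omega) (fun w => ?_)
          rw [cat_append, sw_left hdc.symm, cat_append]
        · rw [List.append_assoc] at hab
          have := (inc_append_left b (a := s ++ r) (b := [])).1 (by simpa using hab)
          simp at this
    intro a b hk hab
    by_cases ha : 3 < a.length
    · exact main a b hk hab ha
    · by_cases hb : 3 < b.length
      · rw [sw_comm]
        exact main b a (by omega) hab.symm hb
      · exact h a b hab (by omega) (by omega)

/-- The group generated by all cone exchanges. -/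
def Vg : Subgroup (Perm Pt) := Subgroup.closure {g | ∃ a b, inc a b ∧ g = sw a b}

theorem sw_mem_Vg {a b : List Bool} (h : inc a b) : sw a b ∈ Vg :=
  Subgroup.subset_closure ⟨a, b, h, rfl⟩

theorem Vg_le {N : Subgroup (Perm Pt)} (h : ∀ a b, inc a b → sw a b ∈ N) : Vg ≤ N := by
  rw [Vg, Subgroup.closure_le]
  rintro _ ⟨a, b, hab, rfl⟩
  exact h a b hab

theorem exists_step {κ : Type*} (s : Finset κ) (c e : κ → List Bool)
    (hc : ∀ i ∈ s, ∀ j ∈ s, i ≠ j → inc (c i) (c j))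
    (he : ∀ i ∈ s, ∀ j ∈ s, i ≠ j → inc (e i) (e j))
    (hce : ∀ i ∈ s, ∀ j ∈ s, inc (c i) (e j)) :
    ∃ v ∈ Vg, (∀ i ∈ s, ∀ w, v (cat (c i) w) = cat (e i) w) ∧
      ∀ x, (∀ i ∈ s, x ∉ Cone (c i) ∧ x ∉ Cone (e i)) → v x = x := by
  classical
  induction s using Finset.induction_on with
  | empty => exact ⟨1, Vg.one_mem, by simp, by simp⟩
  | insert a s ha ih =>
    obtain ⟨v, hv, h1, h2⟩ := ih
      (fun i hi j hj => hc i (Finset.mem_insert_of_mem hi) j (Finset.mem_insert_of_mem hj))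
      (fun i hi j hj => he i (Finset.mem_insert_of_mem hi) j (Finset.mem_insert_of_mem hj))
      (fun i hi j hj => hce i (Finset.mem_insert_of_mem hi) j (Finset.mem_insert_of_mem hj))
    have ma := Finset.mem_insert_self a s
    have ms : ∀ i ∈ s, i ∈ insert a s := fun i hi => Finset.mem_insert_of_mem hi
    have na : ∀ i ∈ s, i ≠ a := fun i hi e => ha (e ▸ hi)
    refine ⟨sw (c a) (e a) * v, Vg.mul_mem (sw_mem_Vg (hce a ma a ma)) hv, ?_, ?_⟩
    · intro i hi w
      rcases Finset.mem_insert.1 hi with rfl | hi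
      · rw [Perm.mul_apply, h2, sw_left (hce i ma i ma)]
        intro j hj
        exact ⟨notMem_cone (hc i ma j (ms j hj) (na j hj).symm) _,
          notMem_cone (hce i ma j (ms j hj)) _⟩
      · rw [Perm.mul_apply, h1 i hi, sw_fix_cat (hce a ma i (ms i hi)).symm
          (he i (ms i hi) a ma (na i hi))]
    · intro x hx
      rw [Perm.mul_apply, h2 x (fun i hi => hx i (ms i hi)), sw_fix (hx a ma).1 (hx a ma).2]

theorem exists_Vg {κ : Type*} (s : Finset κ) (c d : κ → List Bool) (a b : List Bool)
    (hc : ∀ i ∈ s, ∀ j ∈ s, i ≠ j → inc (c i) (c j))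
    (hd : ∀ i ∈ s, ∀ j ∈ s, i ≠ j → inc (d i) (d j))
    (hca : ∀ i ∈ s, inc a (c i)) (hdb : ∀ i ∈ s, inc b (d i)) :
    ∃ v ∈ Vg, ∀ i ∈ s, ∀ w, v (cat (c i) w) = cat (d i) w := by
  wlog hab : inc a b generalizing a b
  · obtain ⟨m, hm1, hm2⟩ : ∃ m, (∀ i ∈ s, inc m (c i)) ∧ (∀ i ∈ s, inc m (d i)) := by
      rcases prefix_of_not_inc hab with ⟨r, rfl⟩ | ⟨r, rfl⟩
      · exact ⟨_, fun i hi => (hca i hi).left r, hdb⟩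
      · exact ⟨_, hca, fun i hi => (hdb i hi).left r⟩
    exact this (m ++ [false]) (m ++ [true]) (fun i hi => (hm1 i hi).left _)
      (fun i hi => (hm2 i hi).left _) (by simp)
  · obtain ⟨v1, hv1, h1, -⟩ := exists_step s c (fun i => a ++ c i) hc
      (fun i hi j hj hij => by simpa using hc i hi j hj hij)
      (fun i hi j hj => ((hca i hi).left _).symm)
    obtain ⟨v2, hv2, h2, -⟩ := exists_step s (fun i => a ++ c i) (fun i => b ++ c i)
      (fun i hi j hj hij => by simpa using hc i hi j hj hij)
      (fun i hi j hj hij => by simpa using hc i hi j hj hij)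
      (fun i hi j hj => hab.append_right _ _)
    obtain ⟨v3, hv3, h3, -⟩ := exists_step s (fun i => b ++ c i) d
      (fun i hi j hj hij => by simpa using hc i hi j hj hij) hd
      (fun i hi j hj => (hdb j hj).left _)
    refine ⟨v3 * v2 * v1, Vg.mul_mem (Vg.mul_mem hv3 hv2) hv1, fun i hi w => ?_⟩
    rw [Perm.mul_apply, Perm.mul_apply, h1 i hi, h2 i hi, h3 i hi]

theorem cat_replicate (n k : ℕ) (w : Pt) :
    cat (List.replicate n false) (cons k w) = cons (k + n) w := by
  induction n with
  | zero => rfl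
  | succ n ih => rw [List.replicate_succ, cat_cons, ih, bit_false_cons]; rfl

theorem inc_num_replicate {n m : ℕ} (h : n < m) : inc (num n) (List.replicate m false) := by
  obtain ⟨k, rfl⟩ := Nat.exists_eq_add_of_le (Nat.succ_le_of_lt h)
  rw [num, show n.succ + k = n + (1 + k) by omega, List.replicate_add]
  simp [List.replicate_add, inc_append_left]

theorem exists_conj_Cn {g : Perm Pt} {n : ℕ} (hg : ∀ w, g (cat (num n) w) = cat (num n) w)
    (c : List Bool) : ∃ v ∈ Vg, v * g * v⁻¹ = Cn c g := by
  have hf : ∀ m, m ≤ n → inc (num n) (if m < n then num m else List.replicate (n + 1) false) := by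
    intro m hm
    split_ifs with h
    · exact inc_num (by omega)
    · exact inc_num_replicate (by omega)
  have hff : ∀ i ∈ Finset.range (n + 1), ∀ j ∈ Finset.range (n + 1), i ≠ j →
      inc (if i < n then num i else List.replicate (n + 1) false)
        (if j < n then num j else List.replicate (n + 1) false) := by
    intro i hi j hj hij
    simp only [Finset.mem_range] at hi hj
    split_ifs with h1 h2 h2
    · exact inc_num hij
    · exact inc_num_replicate (by omega)
    · exact (inc_num_replicate (by omega)).symm
    · omega
  obtain ⟨v, hv, h⟩ := exists_Vg (Finset.range (n + 1))
    (fun m => if m < n then num m else List.replicate (n + 1) false)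
    (fun m => c ++ if m < n then num m else List.replicate (n + 1) false) (num n) (c ++ num n)
    hff (fun i hi j hj hij => (inc_append_left c).2 (hff i hi j hj hij))
    (fun i hi => hf i (by simpa [Nat.lt_succ_iff] using hi))
    (fun i hi => (inc_append_left c).2 (hf i (by simpa [Nat.lt_succ_iff] using hi)))
  have hvx : ∀ x, x ∉ Cone (num n) → v x = cat c x := by
    intro x hx
    obtain ⟨k, w, rfl⟩ := cons_surj x
    have hk : k ≠ n := by
      rintro rfl
      exact hx ⟨w, cat_num _ _⟩
    rcases lt_or_gt_of_ne hk with hk | hk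
    · have := h k (by simp; omega) w
      rw [if_pos hk, cat_append, cat_num] at this
      exact this
    · have := h n (by simp) (cons (k - (n + 1)) w)
      rw [if_neg (lt_irrefl n), cat_append, cat_replicate,
        show k - (n + 1) + (n + 1) = k by omega] at this
      exact this
  have hgx : ∀ x, x ∈ Cone (num n) → g x = x := by
    rintro _ ⟨w, rfl⟩
    exact hg w
  have hgx' : ∀ x, x ∉ Cone (num n) → g x ∉ Cone (num n) := by
    intro x hx h'
    exact hx (g.injective (hgx _ h') ▸ h')
  have hvinv : ∀ y, (∀ x, x ∉ Cone (num n) → y ≠ cat c x) → (v * g * v⁻¹) y = y := by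
    intro y hy
    rw [Perm.mul_apply, Perm.mul_apply, hgx, app_inv]
    by_contra h'
    exact hy _ h' (by rw [← hvx _ h', app_inv])
  refine ⟨v, hv, eq_Cn_of (fun x => ?_) (fun y hy => hvinv y fun x _ e => hy ⟨x, e.symm⟩)⟩
  by_cases hx : x ∈ Cone (num n)
  · rw [hgx x hx, hvinv]
    intro x' hx' e
    exact hx' (cat_inj.1 e ▸ hx)
  · rw [← hvx x hx, Perm.mul_apply, Perm.mul_apply, inv_app, hvx _ (hgx' x hx)]

section
variable (p : ℕ → Perm ℕ)

/-- The permutation acting on the second labels of points with first label `n` by `p n`. -/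
def tau : Perm Pt := Th fun n => io (p n)

theorem tau_num (n : ℕ) (w : Pt) : tau p (cat (num n) w) = cat (num n) (io (p n) w) := by
  rw [cat_num, cat_num, tau, Th_cons]

/-- The group generated by the cone exchanges and their conjugates by `tau p`. -/
def Gam : Subgroup (Perm Pt) := Vg ⊔ Vg.map (MulAut.conj (tau p)).toMonoidHom

variable {p}

theorem Vg_le_Gam : Vg ≤ Gam p := le_sup_left

theorem conj_mem_Gam {v : Perm Pt} (hv : v ∈ Vg) : tau p * v * (tau p)⁻¹ ∈ Gam p :=
  (le_sup_right : _ ≤ Gam p) ⟨v, hv, rfl⟩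

theorem Gam_le_of {N : Subgroup (Perm Pt)} (h1 : Vg ≤ N)
    (h2 : Vg ≤ N.comap (MulAut.conj (tau p)).toMonoidHom) : Gam p ≤ N :=
  sup_le h1 (Subgroup.map_le_iff_le_comap.2 h2)

theorem Gam_le_of_deep {N : Subgroup (Perm Pt)} (m : ℕ)
    (h1 : ∀ a b, inc a b → m ≤ a.length → m ≤ b.length → sw a b ∈ N)
    (h2 : ∀ a b, inc a b → m ≤ a.length → m ≤ b.length → tau p * sw a b * (tau p)⁻¹ ∈ N) :
    Gam p ≤ N :=
  Gam_le_of (Vg_le fun _ _ h => sw_mem_of_deep N m h1 h)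
    (Vg_le fun _ _ h => sw_mem_of_deep _ m h2 h)

theorem Gam_fg : ∃ T : Set (Perm Pt), T.Finite ∧ Subgroup.closure T = Gam p := by
  have hfin : {l : List Bool | l.length ≤ 3}.Finite := List.finite_length_le _ _
  set A : Set (Perm Pt) := {g | ∃ a b, inc a b ∧ a.length ≤ 3 ∧ b.length ≤ 3 ∧ g = sw a b}
  have hA : A.Finite := by
    refine ((hfin.prod hfin).image fun q => sw q.1 q.2).subset ?_
    rintro _ ⟨a, b, -, h1, h2, rfl⟩
    exact ⟨(a, b), ⟨h1, h2⟩, rfl⟩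
  refine ⟨A ∪ (MulAut.conj (tau p)).toMonoidHom '' A, hA.union (hA.image _), le_antisymm ?_ ?_⟩
  · rw [Subgroup.closure_le]
    rintro _ (⟨a, b, h, -, -, rfl⟩ | ⟨_, ⟨a, b, h, -, -, rfl⟩, rfl⟩)
    · exact Vg_le_Gam (sw_mem_Vg h)
    · exact conj_mem_Gam (sw_mem_Vg h)
  · apply Gam_le_of
    · exact Vg_le fun _ _ h => sw_mem_of_short _
        (fun a b h ha hb => Subgroup.subset_closure (Or.inl ⟨a, b, h, ha, hb, rfl⟩)) h
    · refine Vg_le fun _ _ h => sw_mem_of_short _ (fun a b h ha hb => ?_) h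
      exact Subgroup.subset_closure (Or.inr ⟨_, ⟨a, b, h, ha, hb, rfl⟩, rfl⟩)

theorem exists_num_inc {a b : List Bool} (ha : 2 ≤ a.length) (hb : 2 ≤ b.length) :
    ∃ n, inc (num n) a ∧ inc (num n) b := by
  match a, ha, b, hb with
  | x :: y :: a, _, u :: v :: b, _ =>
    by_cases h0 : x = false ∧ u = false
    · exact ⟨0, by simp [num_zero, h0]⟩
    · by_cases h1 : (x = true ∨ y = false) ∧ (u = true ∨ v = false)
      · exact ⟨1, by simp [num_succ, num_zero]; grind⟩
      · exact ⟨2, by simp [num_succ, num_zero]; grind⟩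

/-- An induction principle for the inclusion of `Gam p` in a subgroup, with generators that are
commutators and fix a cone pointwise. -/
theorem Gam_le_of_generators {N : Subgroup (Perm Pt)}
    (h : ∀ b b' : Perm Pt, b ∈ Gam p → b' ∈ Gam p → ∀ n,
      (∀ w, ⁅b, b'⁆ (cat (num n) w) = cat (num n) w) → ⁅b, b'⁆ ∈ N) : Gam p ≤ N := by
  have hs : ∀ a b, inc a b → 2 ≤ a.length → 2 ≤ b.length →
      ∃ v ∈ Vg, ∃ v' ∈ Vg, sw a b = ⁅v, v'⁆ ∧ ∃ n, ∀ w, sw a b (cat (num n) w) = cat (num n) w := by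
    intro a b hab ha hb
    obtain ⟨n, hn1, hn2⟩ := exists_num_inc ha hb
    exact ⟨_, sw_mem_Vg (hab.append_right _ _), _, Vg.mul_mem (sw_mem_Vg (by simp))
      (sw_mem_Vg (by simp)), sw_eq_commutator hab, n, sw_fix_cat hn1 hn2⟩
  apply Gam_le_of_deep 2
  · intro a b hab ha hb
    obtain ⟨v, hv, v', hv', e, n, hn⟩ := hs a b hab ha hb
    rw [e] at hn ⊢
    exact h v v' (Vg_le_Gam hv) (Vg_le_Gam hv') n hn
  · intro a b hab ha hb
    obtain ⟨v, hv, v', hv', e, n, hn⟩ := hs a b hab ha hb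
    rw [e] at hn ⊢
    rw [show tau p * ⁅v, v'⁆ * (tau p)⁻¹ = ⁅tau p * v * (tau p)⁻¹, tau p * v' * (tau p)⁻¹⁆ from
      map_commutatorElement (MulAut.conj (tau p)).toMonoidHom v v']
    refine h _ _ (conj_mem_Gam hv) (conj_mem_Gam hv') n fun w => ?_
    rw [← show tau p * ⁅v, v'⁆ * (tau p)⁻¹ = ⁅tau p * v * (tau p)⁻¹, tau p * v' * (tau p)⁻¹⁆ from
      map_commutatorElement (MulAut.conj (tau p)).toMonoidHom v v']
    have : (tau p)⁻¹ (cat (num n) w) = cat (num n) ((io (p n))⁻¹ w) := by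
      rw [Perm.inv_eq_iff_eq, tau_num, app_inv]
    rw [Perm.mul_apply, Perm.mul_apply, this, hn, tau_num, app_inv]

theorem Cn_mem_Gam (c : List Bool) {g : Perm Pt} (hg : g ∈ Gam p) : Cn c g ∈ Gam p := by
  have : Gam p ≤ (Gam p).comap (Cn c) := by
    refine Gam_le_of_generators fun b b' hb hb' n hn => ?_
    obtain ⟨v, hv, e⟩ := exists_conj_Cn hn c
    rw [Subgroup.mem_comap, ← e]
    refine mul_mem (mul_mem (Vg_le_Gam hv) ?_) (inv_mem (Vg_le_Gam hv))
    rw [commutatorElement_def]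
    exact mul_mem (mul_mem (mul_mem hb hb') (inv_mem hb)) (inv_mem hb')
  exact this hg

theorem Gam_le_of_normalized {N : Subgroup (Perm Pt)}
    (hN : ∀ γ ∈ Gam p, ∀ n ∈ N, γ * n * γ⁻¹ ∈ N) {n : Perm Pt} (hn : n ∈ N) {c : List Bool}
    (hc : ∀ w, n (cat c w) ∉ Cone c) : Gam p ≤ N := by
  refine Gam_le_of_generators fun b b' hb hb' k hk => ?_
  obtain ⟨v, hv, e⟩ := exists_conj_Cn hk c
  have hCb := Cn_mem_Gam c hb
  have hCb' := Cn_mem_Gam c hb'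
  have hcomm : ⁅⁅Cn c b, n⁆, Cn c b'⁆ ∈ N := by
    have h1 : ⁅Cn c b, n⁆ ∈ N := by
      rw [commutatorElement_def]
      exact mul_mem (hN _ hCb _ hn) (inv_mem hn)
    rw [commutatorElement_def, mul_assoc, mul_assoc, ← mul_assoc (Cn c b')]
    exact mul_mem h1 (hN _ hCb' _ (inv_mem h1))
  have hd : Commute (n * (Cn c b)⁻¹ * n⁻¹) (Cn c b') := by
    rw [← map_inv]
    ext x
    simp only [Perm.mul_apply]
    by_cases hx : x ∈ Cone c
    · have hx' : ∀ w, n⁻¹ (cat c w) ∉ Cone c := by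
        rintro w ⟨w', hw'⟩
        rw [Perm.eq_inv_iff_eq] at hw'
        exact hc w' ⟨w, hw'.symm⟩
      obtain ⟨w, rfl⟩ := hx
      rw [Cn_cat, Cn_fix _ (hx' _), Cn_fix _ (hx' _), app_inv, app_inv, Cn_cat]
    · rw [Cn_fix b' hx]
      by_cases hx' : n⁻¹ x ∈ Cone c
      · obtain ⟨w, hw⟩ := hx'
        rw [← hw, Cn_cat, Cn_fix b' (hc _)]
      · rw [Cn_fix _ hx', app_inv, Cn_fix b' hx]
  have e2 : ⁅⁅Cn c b, n⁆, Cn c b'⁆ = Cn c ⁅b, b'⁆ := by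
    have : ⁅Cn c b, n⁆ = Cn c b * (n * (Cn c b)⁻¹ * n⁻¹) := by
      simp [commutatorElement_def, mul_assoc]
    rw [this, map_commutatorElement, commutatorElement_def, mul_assoc (Cn c b), hd.eq]
    simp [commutatorElement_def, mul_assoc]
  rw [e2, ← e] at hcomm
  have := hN _ (inv_mem (Vg_le_Gam hv)) _ hcomm
  simpa [mul_assoc] using this

theorem exists_num_append (c : List Bool) : ∃ n e, c ++ [true] = num n ++ e := by
  induction c with
  | nil => exact ⟨0, [], rfl⟩
  | cons x c ih =>
    obtain ⟨n, e, h⟩ := ih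
    cases x
    · exact ⟨n + 1, e, by simp [h, num_succ]⟩
    · exact ⟨0, c ++ [true], by simp [num_zero]⟩

/-- The group of permutations such that they and their inverses map every cone onto a set
containing a cone. -/
def coneImageGroup : Subgroup (Perm Pt) where
  carrier := {g | (∀ c, ∃ d, ∀ w, ∃ w', g (cat c w') = cat d w) ∧
    ∀ c, ∃ d, ∀ w, ∃ w', g⁻¹ (cat c w') = cat d w}
  one_mem' := ⟨fun c => ⟨c, fun w => ⟨w, rfl⟩⟩, fun c => ⟨c, fun w => ⟨w, by simp⟩⟩⟩
  inv_mem' h := by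
    refine ⟨h.2, ?_⟩
    rw [inv_inv]
    exact h.1
  mul_mem' {x y} hx hy := by
    have hmul : ∀ x y : Perm Pt, (∀ c, ∃ d, ∀ w, ∃ w', x (cat c w') = cat d w) →
        (∀ c, ∃ d, ∀ w, ∃ w', y (cat c w') = cat d w) →
        ∀ c, ∃ d, ∀ w, ∃ w', (x * y) (cat c w') = cat d w := by
      intro x y hx hy c
      obtain ⟨d, hd⟩ := hy c
      obtain ⟨d', hd'⟩ := hx d
      refine ⟨d', fun w => ?_⟩
      obtain ⟨w', h1⟩ := hd' w
      obtain ⟨w'', h2⟩ := hd w'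
      exact ⟨w'', by rw [Perm.mul_apply, h2, h1]⟩
    refine ⟨hmul _ _ hx.1 hy.1, ?_⟩
    rw [mul_inv_rev]
    exact hmul _ _ hy.2 hx.2

theorem sw_mem_coneImageGroup {a b : List Bool} (hab : inc a b) : sw a b ∈ coneImageGroup := by
  suffices H : ∀ c, ∃ d, ∀ w, ∃ w', sw a b (cat c w') = cat d w from ⟨H, by rwa [sw_inv]⟩
  intro c
  set c' := c ++ List.replicate (a.length + b.length + 1) false with hc'
  suffices H : ∃ d, ∀ w, sw a b (cat c' w) = cat d w by
    obtain ⟨d, hd⟩ := H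
    exact ⟨d, fun w => ⟨_, by rw [← cat_append]; exact hd w⟩⟩
  have hpre : ∀ e, e.length ≤ a.length + b.length → ¬ inc e c' → ∃ r, c' = e ++ r := by
    intro e he h
    rcases prefix_of_not_inc h with h | ⟨r, h⟩
    · exact h
    · have := congrArg List.length h
      simp [c'] at this
      omega
  by_cases ha : inc a c'
  · by_cases hb : inc b c'
    · exact ⟨c', sw_fix_cat ha.symm hb.symm⟩
    · obtain ⟨r, hr⟩ := hpre b (by omega) hb
      exact ⟨a ++ r, fun w => by rw [hr, cat_append, sw_right hab, cat_append]⟩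
  · obtain ⟨r, hr⟩ := hpre a (by omega) ha
    exact ⟨b ++ r, fun w => by rw [hr, cat_append, sw_left hab, cat_append]⟩

theorem tau_mem_coneImageGroup : tau p ∈ coneImageGroup := by
  have htau : ∀ c, ∃ n m e, c ++ [true] ++ [true] = num n ++ (num m ++ e) := by
    intro c
    obtain ⟨n, e, h⟩ := exists_num_append c
    obtain ⟨m, e', h'⟩ := exists_num_append e
    exact ⟨n, m, e', by rw [h, List.append_assoc, h']⟩
  constructor
  · intro c
    obtain ⟨n, m, e, h⟩ := htau c
    refine ⟨num n ++ (num (p n m) ++ e), fun w => ⟨cat [true] (cat [true] w), ?_⟩⟩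
    rw [← cat_append, ← cat_append, h, cat_append, tau_num, cat_append, io_num, cat_append,
      cat_append]
  · intro c
    obtain ⟨n, m, e, h⟩ := htau c
    refine ⟨num n ++ (num ((p n)⁻¹ m) ++ e), fun w => ⟨cat [true] (cat [true] w), ?_⟩⟩
    rw [Perm.inv_eq_iff_eq, ← cat_append, ← cat_append, h]
    simp only [cat_append, tau_num, io_num, app_inv]

theorem exists_cone_image {g : Perm Pt} (hg : g ∈ Gam p) (c : List Bool) :
    ∃ d, ∀ w, ∃ w', g (cat c w') = cat d w := by
  have hV : Vg ≤ coneImageGroup := Vg_le fun _ _ => sw_mem_coneImageGroup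
  have : Gam p ≤ coneImageGroup := by
    refine Gam_le_of hV fun v hv => ?_
    exact mul_mem (mul_mem tau_mem_coneImageGroup (hV hv)) (inv_mem tau_mem_coneImageGroup)
  exact (this hg).1 c

theorem Gam_le_of_fix {N : Subgroup (Perm Pt)} {c d e : List Bool} (hcd : inc c d)
    (hec : inc e c) (hed : inc e d)
    (hc : ∀ g ∈ Gam p, (∀ w, g (cat c w) = cat c w) → g ∈ N)
    (hd : ∀ g ∈ Gam p, (∀ w, g (cat d w) = cat d w) → g ∈ N) : Gam p ≤ N := by
  have hswc : ∀ a b, inc a b → inc c a → inc c b → sw a b ∈ N := fun a b hab ha hb =>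
    hc _ (Vg_le_Gam (sw_mem_Vg hab)) (sw_fix_cat ha hb)
  have hswd : ∀ a b, inc a b → inc d a → inc d b → sw a b ∈ N := fun a b hab ha hb =>
    hd _ (Vg_le_Gam (sw_mem_Vg hab)) (sw_fix_cat ha hb)
  have hbad : ∀ r s, sw (c ++ r) (d ++ s) ∈ N := by
    intro r s
    have h1 : inc (c ++ r) e := hec.symm.left r
    have h2 : inc (d ++ s) e := hed.symm.left s
    rw [sw_trans (hcd.append_right r s) h1 h2]
    have h3 := hswd _ _ h1 (hcd.symm.right r) hed.symm
    exact mul_mem (mul_mem h3 (hswc _ _ h2.symm hec.symm (hcd.right s))) (inv_mem h3)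
  have hV : Vg ≤ N := by
    refine Vg_le fun _ _ h => sw_mem_of_deep N (c.length + d.length) (fun a b hab ha hb => ?_) h
    have hpre : ∀ c' a', c'.length ≤ c.length + d.length → c.length + d.length ≤ a'.length →
        ¬ inc c' a' → ∃ r, a' = c' ++ r := by
      intro c' a' h1 h2 h
      rcases prefix_of_not_inc h with h | ⟨r, h⟩
      · exact h
      · have := congrArg List.length h
        simp at this
        obtain rfl : r = [] := List.eq_nil_of_length_eq_zero (by omega)
        exact ⟨[], by simp [h]⟩
    have hcne : ∀ r s, ¬ c ++ r = d ++ s := fun r s h => inc_self _ (h ▸ hcd.append_right r s)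
    by_cases hca : inc c a
    · by_cases hcb : inc c b
      · exact hswc a b hab hca hcb
      · obtain ⟨r, rfl⟩ := hpre c b (by omega) hb hcb
        by_cases hda : inc d a
        · exact hswd _ _ hab hda (hcd.symm.right r)
        · obtain ⟨s, rfl⟩ := hpre d a (by omega) ha hda
          rw [sw_comm]
          exact hbad r s
    · obtain ⟨r, rfl⟩ := hpre c a (by omega) ha hca
      by_cases hdb : inc d b
      · exact hswd _ _ hab (hcd.symm.right r) hdb
      · obtain ⟨s, rfl⟩ := hpre d b (by omega) hb hdb
        exact hbad r s
  refine Gam_le_of_generators fun b b' hb hb' n hn => ?_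
  obtain ⟨v, hv, h⟩ := exists_Vg {()} (fun _ => num n) (fun _ => c) (num (n + 1)) d
    (by simp) (by simp) (by simp [inc_num]) (by simp [hcd.symm])
  have h' : ∀ w, v⁻¹ (cat c w) = cat (num n) w := fun w => by
    rw [Perm.inv_eq_iff_eq, h () (by simp)]
  have hvΓ : v ∈ Gam p := Vg_le_Gam hv
  have hbb : ⁅b, b'⁆ ∈ Gam p := by
    rw [commutatorElement_def]
    exact mul_mem (mul_mem (mul_mem hb hb') (inv_mem hb)) (inv_mem hb')
  have := hc (v * ⁅b, b'⁆ * v⁻¹) (mul_mem (mul_mem hvΓ hbb) (inv_mem hvΓ))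
    (fun w => by rw [Perm.mul_apply, Perm.mul_apply, h', hn, h () (by simp)])
  have := mul_mem (mul_mem (inv_mem (hV hv)) this) (hV hv)
  simpa [mul_assoc] using this

theorem Cn_num_eq_Th (n : ℕ) (g : Perm Pt) : Cn (num n) g = Th (Pi.mulSingle n g) := by
  symm
  apply eq_Cn_of
  · intro w
    rw [cat_num, cat_num, Th_cons, Pi.mulSingle_eq_same]
  · intro x hx
    obtain ⟨m, w, rfl⟩ := cons_surj x
    have : m ≠ n := by
      rintro rfl
      exact hx ⟨w, cat_num _ _⟩
    rw [Th_cons, Pi.mulSingle_eq_of_ne this]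
    rfl

theorem Cn_commutator_mem (h0 : p 0 = 1) {n m : ℕ} (hn : n ≠ 0) (hm : m ≠ 0) :
    Cn [true] (io ⁅p n, p m⁆) ∈ Gam p := by
  rcases eq_or_ne n m with rfl | hnm
  · simp
  set f : ℕ → ℕ → Perm Pt := fun n =>
    Pi.mulSingle 0 (io (p n)) * Pi.mulSingle n (io (p n))⁻¹ with hf
  have hmem : ∀ n, n ≠ 0 → Th (f n) ∈ Gam p := by
    intro n hn
    have hi : inc (num 0) (num n) := inc_num hn.symm
    have e : sw (num 0) (num n) * (tau p * sw (num 0) (num n) * (tau p)⁻¹) = Th (f n) := by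
      have ht : ∀ n w, tau p (cons n w) = cons n (io (p n) w) := fun n w => by
        simpa [cat_num] using tau_num p n w
      have hti : ∀ n w, (tau p)⁻¹ (cons n w) = cons n ((io (p n))⁻¹ w) := fun n w => by
        rw [Perm.inv_eq_iff_eq, ht, app_inv]
      have hs0 : ∀ w, sw (num 0) (num n) (cons 0 w) = cons n w := fun w => by
        simpa only [cat_num] using sw_left hi w
      have hsn : ∀ w, sw (num 0) (num n) (cons n w) = cons 0 w := fun w => by
        simpa only [cat_num] using sw_right hi w
      ext x
      obtain ⟨l, w, rfl⟩ := cons_surj x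
      simp only [Perm.mul_apply, hti, Th_cons]
      by_cases hl0 : l = 0
      · subst hl0
        rw [hs0, ht, hsn, h0]
        simp [f, Pi.mulSingle_eq_of_ne hn.symm]
      · by_cases hln : l = n
        · subst hln
          rw [hsn, ht, hs0, h0]
          simp [f, Pi.mulSingle_eq_of_ne hn]
        · have hfix : ∀ w, sw (num 0) (num n) (cons l w) = cons l w := fun w => by
            simpa only [cat_num] using sw_fix_cat (inc_num hl0) (inc_num hln) w
          rw [hfix, ht, hfix, app_inv]
          simp [f, Pi.mulSingle_eq_of_ne hl0, Pi.mulSingle_eq_of_ne hln]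
    rw [← e]
    exact mul_mem (Vg_le_Gam (sw_mem_Vg hi)) (conj_mem_Gam (sw_mem_Vg hi))
  have e : Cn [true] (io ⁅p n, p m⁆) = ⁅Th (f n), Th (f m)⁆ := by
    rw [← num_zero, Cn_num_eq_Th, ← map_commutatorElement]
    congr 1
    ext1 l
    rw [commutatorElement_def, commutatorElement_def]
    by_cases hl0 : l = 0
    · subst hl0
      simp [f, Pi.mulSingle_eq_of_ne hn.symm, Pi.mulSingle_eq_of_ne hm.symm]
    · by_cases hln : l = n
      · subst hln
        simp [f, Pi.mulSingle_eq_of_ne hn, Pi.mulSingle_eq_of_ne hnm]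
      · simp [f, Pi.mulSingle_eq_of_ne hl0, Pi.mulSingle_eq_of_ne hln]
  rw [e, commutatorElement_def]
  exact mul_mem (mul_mem (mul_mem (hmem n hn) (hmem m hm)) (inv_mem (hmem n hn)))
    (inv_mem (hmem m hm))

end
instance : Inhabited Pt := ⟨(0 : ℕ)⟩

/-- The word of two labels, the first of which is `0`. -/
def D (n : ℕ) : List Bool := num 0 ++ num n

theorem inc_D {n m : ℕ} (h : n ≠ m) : inc (D n) (D m) := (inc_append_left _).2 (inc_num h)

theorem conj_Cn' {c d : List Bool} {v γ : Perm Pt} (h : ∀ w, v (cat c w) = cat d (γ w))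
    (m : Perm Pt) : v * Cn c m * v⁻¹ = Cn d (γ * m * γ⁻¹) := by
  have := conj_Cn (v := v * Cn c γ⁻¹) (c := c) (d := d)
    (fun w => by rw [Perm.mul_apply, Cn_cat, h, app_inv]) (γ * m * γ⁻¹)
  rw [← this]
  simp [mul_assoc]

/-- The product of two homomorphisms with commuting images. -/
def prodHom {A B : Type*} [Group A] [Group B] (f f' : A →* B) (h : ∀ a b, Commute (f a) (f' b)) :
    A →* B where
  toFun a := f a * f' a
  map_one' := by simp
  map_mul' a b := by
    rw [map_mul, map_mul]
    exact (h b a).mul_mul_mul_comm _ _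

/-- The homomorphism to permutations which on suitable disjoint cones acts as the conjugates by
the elements of a list of the action on labels following the letter `true`. -/
noncomputable def Ahom (s t : List Bool) (hst : inc s t) : List (Perm Pt) → Perm ℕ →* Perm Pt
  | [] => 1
  | c :: L =>
    prodHom ((Cn t).comp ((MulAut.conj c).toMonoidHom.comp ((Cn [true]).comp io)))
      ((Cn s).comp (Ahom s t hst L)) fun _ _ => Cn_mul_comm hst.symm _ _

theorem Ahom_cons {s t : List Bool} (hst : inc s t) (c : Perm Pt) (L : List (Perm Pt))
    (g : Perm ℕ) : Ahom s t hst (c :: L) g =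
      Cn t (c * Cn [true] (io g) * c⁻¹) * Cn s (Ahom s t hst L g) := rfl

theorem Ahom_mem {p : ℕ → Perm ℕ} {s t : List Bool} (hst : inc s t) {L : List (Perm Pt)}
    (hL : ∀ c ∈ L, c ∈ Gam p) {g : Perm ℕ} (hg : Cn [true] (io g) ∈ Gam p) :
    Ahom s t hst L g ∈ Gam p := by
  induction L with
  | nil => exact one_mem _
  | cons c L ih =>
    have hc : c ∈ Gam p := hL c (by simp)
    rw [Ahom_cons]
    exact mul_mem (Cn_mem_Gam _ (mul_mem (mul_mem hc hg) (inv_mem hc)))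
      (Cn_mem_Gam _ (ih fun c hc => hL c (by simp [hc])))

theorem exists_mem_Ahom {Λ : Subgroup (Perm Pt)} {s t d : List Bool} (hst : inc s t)
    {a b : Perm Pt} (ha : a ∈ Λ) (hb : b ∈ Λ) (has : ∀ w, a (cat d w) = cat d (cat s w))
    (hbt : ∀ w, b (cat d w) = cat d (cat t w)) {L : List (Perm Pt)} {c : Perm Pt} (hc : c ∈ L) :
    ∃ r, (∃ u ∈ Λ, ∀ w, u (cat d w) = cat d (cat r w)) ∧
      ∀ g w, Ahom s t hst L g (cat r w) = cat r ((c * Cn [true] (io g) * c⁻¹) w) := by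
  induction L with
  | nil => simp at hc
  | cons c' L ih =>
    rcases List.mem_cons.1 hc with rfl | hc
    · refine ⟨t, ⟨b, hb, hbt⟩, fun g w => ?_⟩
      rw [Ahom_cons, Perm.mul_apply, Cn_fix_cat hst.symm, Cn_cat]
    · obtain ⟨r, ⟨u, hu, hud⟩, hr⟩ := ih hc
      refine ⟨s ++ r, ⟨a * u, mul_mem ha hu, fun w => ?_⟩, fun g w => ?_⟩
      · rw [Perm.mul_apply, hud, has, cat_append]
      · rw [Ahom_cons, Perm.mul_apply, cat_append, Cn_cat, hr, Cn_fix_cat hst, cat_append]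

section
variable {p : ℕ → Perm ℕ} {G : Subgroup (Perm ℕ)} {e s t : List Bool}
  {φ : Perm ℕ →* Perm Pt} {x : Perm Pt} {y h h' : Perm ℕ}

theorem contraction (hG : ∀ g ∈ G, g 0 = 0 → g = 1) (he : inc e [true])
    (hφD : ∀ g n w, φ g (cat (D n) w) = cat (D (g n)) w)
    (hφe : ∀ g w, φ g (cat e w) ∈ Cone e)
    (hyG : y ∈ G) (hhG : h ∈ G) (hy : y ≠ 1) (hh : h ≠ 1) (hhy : h ≠ y)
    (hcase : (y * y ≠ 1 ∧ h = y⁻¹ ∧ h' = y) ∨ (h * y ≠ 1 ∧ h' = h))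
    (hQ : ∀ q, q ∉ Cone (D 0) → q ∉ Cone e → x q ∈ Cone (D 0) ∨ x q ∈ Cone e)
    (hQ' : ∀ q, q ∉ Cone (D 0) → q ∉ Cone e → x⁻¹ q ∈ Cone (D 0) ∨ x⁻¹ q ∈ Cone e)
    (hys : ∀ w, x (cat (D (y 0)) (cat s w)) = cat (D 0) (cat t w))
    (hyt : ∀ w, x (cat (D (y 0)) (cat t w)) = cat e w)
    (hQQ : ∀ q q', q ∉ Cone (D 0) → q ∉ Cone e → q' ∉ Cone (D 0) → q' ∉ Cone e →
      x⁻¹ q = x q' → q = q') (r : Pt) (hr : r ∉ Cone (D 0)) :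
    (x * φ h' * x⁻¹ * φ h * x⁻¹) r ∈ Cone (D 0) := by
  have hG' : ∀ g ∈ G, ∀ g' ∈ G, g ≠ g' → g 0 ≠ g' 0 := by
    intro g hg g' hg' hne h0
    apply hne
    have := hG (g'⁻¹ * g) (mul_mem (inv_mem hg') hg) (by rw [Perm.mul_apply, h0, inv_app])
    exact (inv_mul_eq_one.1 this).symm
  have hG0 : ∀ g ∈ G, g ≠ 1 → g 0 ≠ 0 := fun g hg h h0 => h (hG g hg h0)
  have heD : ∀ n, inc e (D n) := fun n => he.right (num n)
  have nD : ∀ n, n ≠ 0 → ∀ w, cat (D n) w ∉ Cone (D 0) := fun n hn w => notMem_cone (inc_D hn) w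
  have ne : ∀ n w, cat (D n) w ∉ Cone e := fun n w => notMem_cone (heD n).symm w
  have ye : ∀ w, x⁻¹ (cat e w) = cat (D (y 0)) (cat t w) := fun w => by
    rw [Perm.inv_eq_iff_eq, hyt]
  -- points sent into the exceptional cone
  have xe : ∀ q, x q ∈ Cone e → ∃ w, q = cat (D (y 0)) (cat t w) := by
    rintro q ⟨w, hw⟩
    exact ⟨w, x.injective (by rw [hyt, hw])⟩
  have xe' : ∀ q, q ∉ Cone (D 0) → q ∉ Cone e → x⁻¹ q ∈ Cone e →
      ∃ w, q = cat (D (y 0)) (cat t w) := by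
    rintro q h1 h2 ⟨w, hw⟩
    refine ⟨w, hQQ _ _ h1 h2 (nD _ (hG0 y hyG hy) _) (ne _ _) ?_⟩
    rw [hyt, hw]
  have xD : ∀ n w, n ≠ 0 → n ≠ y 0 → x (cat (D n) w) ∈ Cone (D 0) := by
    intro n w hn hny
    refine (hQ _ (nD n hn w) (ne n w)).resolve_right fun h => ?_
    obtain ⟨w', hw'⟩ := xe _ h
    exact cat_ne (inc_D hny) _ _ hw'
  have xD' : ∀ n w, n ≠ 0 → n ≠ y 0 → x⁻¹ (cat (D n) w) ∈ Cone (D 0) := by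
    intro n w hn hny
    refine (hQ' _ (nD n hn w) (ne n w)).resolve_right fun h => ?_
    obtain ⟨w', hw'⟩ := xe' _ (nD n hn w) (ne n w) h
    exact cat_ne (inc_D hny) _ _ hw'
  have h0 := hG0 h hhG hh
  have hy0 := hG0 y hyG hy
  have hhy0 := hG' h hhG y hyG hhy
  have first : (∃ w, x⁻¹ r = cat (D 0) w) ∨ (∃ w, x⁻¹ r = cat (D (y 0)) (cat t w)) ∨
      (∃ w, x⁻¹ r = cat e w) := by
    by_cases hre : r ∈ Cone e
    · obtain ⟨w, rfl⟩ := hre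
      exact Or.inr (Or.inl ⟨w, ye w⟩)
    · rcases hQ' r hr hre with ⟨w, hw⟩ | ⟨w, hw⟩
      · exact Or.inl ⟨w, hw.symm⟩
      · exact Or.inr (Or.inr ⟨w, hw.symm⟩)
  simp only [Perm.mul_apply]
  rcases hcase with ⟨hyy, rfl, rfl⟩ | ⟨hhy1, rfl⟩
  · have hyy0 : h' (h' 0) ≠ 0 := hG0 (h' * h') (mul_mem hyG hyG) hyy
    have hyyy : h' (h' 0) ≠ h' 0 := fun e => hy0 (h'.injective e)
    rcases first with ⟨w, hw⟩ | ⟨w, hw⟩ | ⟨w, hw⟩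
    · rw [hw, hφD]
      obtain ⟨w', hw'⟩ := xD' _ w h0 hhy0
      rw [← hw', hφD]
      refine (hQ _ (nD _ hy0 _) (ne _ _)).resolve_right fun hh => ?_
      obtain ⟨v, hv⟩ := xe _ hh
      rw [cat_inj] at hv
      subst hv
      rw [← hys] at hw'
      have := hQQ _ _ (nD _ h0 w) (ne _ w) (nD _ hy0 (cat s v)) (ne _ _) hw'.symm
      exact cat_ne (inc_D hhy0) _ _ this
    · rw [hw, hφD, inv_app, show x⁻¹ (cat (D 0) (cat t w)) = cat (D (h' 0)) (cat s w) by
        rw [Perm.inv_eq_iff_eq, hys], hφD]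
      exact xD _ _ hyy0 hyyy
    · rw [hw]
      obtain ⟨w', hw'⟩ := hφe h'⁻¹ w
      rw [← hw', ye, hφD]
      exact xD _ _ hyy0 hyyy
  · have hhy2 : h' (y 0) ≠ 0 := hG0 (h' * y) (mul_mem hhG hyG) hhy1
    have hhy3 : h' (y 0) ≠ y 0 := hG' (h' * y) (mul_mem hhG hyG) y hyG (by simpa using hh)
    have last : ∀ z, z ∈ Cone (D 0) → x (φ h' z) ∈ Cone (D 0) := by
      rintro _ ⟨w, rfl⟩
      rw [hφD]
      exact xD _ _ h0 hhy0
    rcases first with ⟨w, hw⟩ | ⟨w, hw⟩ | ⟨w, hw⟩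
    · rw [hw, hφD]
      exact last _ (xD' _ _ h0 hhy0)
    · rw [hw, hφD]
      exact last _ (xD' _ _ hhy2 hhy3)
    · rw [hw]
      obtain ⟨w', hw'⟩ := hφe h' w
      rw [← hw', ye, hφD]
      exact xD _ _ hhy2 hhy3

theorem Gam_le_of_pair {Λ : Subgroup (Perm Pt)} (hΛ : Λ ≤ Gam p)
    (hG : ∀ g ∈ G, g 0 = 0 → g = 1) (he : inc e [true]) (hst : inc s t)
    {L : List (Perm Pt)}
    (hL : ∀ N : Subgroup (Perm Pt),
      (∀ c ∈ L, ∀ g ∈ G, c * Cn [true] (io g) * c⁻¹ ∈ N) → Gam p ≤ N)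
    (hφΛ : ∀ g ∈ G, φ g ∈ Λ) (hφD : ∀ g n w, φ g (cat (D n) w) = cat (D (g n)) w)
    (hφe : ∀ g w, φ g (cat e w) = cat e (Cn s (Ahom s t hst L g) w)) (hx : x ∈ Λ)
    (hyG : y ∈ G) (hhG : h ∈ G) (hy : y ≠ 1) (hh : h ≠ 1) (hhy : h ≠ y)
    (hcase : (y * y ≠ 1 ∧ h = y⁻¹ ∧ h' = y) ∨ (h * y ≠ 1 ∧ h' = h))
    (hQ : ∀ q, q ∉ Cone (D 0) → q ∉ Cone e → x q ∈ Cone (D 0) ∨ x q ∈ Cone e)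
    (hQ' : ∀ q, q ∉ Cone (D 0) → q ∉ Cone e → x⁻¹ q ∈ Cone (D 0) ∨ x⁻¹ q ∈ Cone e)
    (hxh : ∀ w, x (cat (D (h 0)) w) = cat (D 0) (cat s w))
    (hys : ∀ w, x (cat (D (y 0)) (cat s w)) = cat (D 0) (cat t w))
    (hyt : ∀ w, x (cat (D (y 0)) (cat t w)) = cat e w)
    (hQQ : ∀ q q', q ∉ Cone (D 0) → q ∉ Cone e → q' ∉ Cone (D 0) → q' ∉ Cone e →
      x⁻¹ q = x q' → q = q') : Gam p ≤ Λ := by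
  have hφh' : φ h' ∈ Λ := by
    rcases hcase with ⟨-, -, rfl⟩ | ⟨-, rfl⟩
    · exact hφΛ _ hyG
    · exact hφΛ _ hhG
  have hφh := hφΛ h hhG
  have hφy := hφΛ y hyG
  have hy0 : y 0 ≠ 0 := fun h0 => hy (hG y hyG h0)
  have hk := contraction hG he hφD (fun g w => by rw [hφe]; exact mem_cone _ _) hyG hhG hy hh hhy
    hcase hQ hQ' hys hyt hQQ
  set k := x * φ h' * x⁻¹ * φ h * x⁻¹
  have hkΛ : k ∈ Λ :=
    mul_mem (mul_mem (mul_mem (mul_mem hx hφh') (inv_mem hx)) hφh) (inv_mem hx)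
  obtain ⟨a, ha, haD⟩ : ∃ a ∈ Λ, ∀ w, a (cat (D 0) w) = cat (D 0) (cat s w) :=
    ⟨x * φ h, mul_mem hx hφh, fun w => by rw [Perm.mul_apply, hφD, hxh]⟩
  obtain ⟨b, hb, hbD⟩ : ∃ b ∈ Λ, ∀ w, b (cat (D 0) w) = cat (D 0) (cat t w) :=
    ⟨x * φ y * a, mul_mem (mul_mem hx hφy) ha, fun w => by
      rw [Perm.mul_apply, haD, Perm.mul_apply, hφD, hys]⟩
  obtain ⟨g, hg, hgD⟩ : ∃ g ∈ Λ, ∀ w, g (cat (D 0) w) = cat e w :=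
    ⟨x * φ y * b, mul_mem (mul_mem hx hφy) hb, fun w => by
      rw [Perm.mul_apply, hbD, Perm.mul_apply, hφD, hyt]⟩
  -- every element of `Gam p` is induced on the cone `D 0` by an element of `Λ`
  have hM : ∀ γ ∈ Gam p, ∃ l ∈ Λ, ∀ w, l (cat (D 0) w) = cat (D 0) (γ w) := by
    let M : Subgroup (Perm Pt) :=
      { carrier := {γ | ∃ l ∈ Λ, ∀ w, l (cat (D 0) w) = cat (D 0) (γ w)}
        one_mem' := ⟨1, one_mem _, fun w => rfl⟩
        mul_mem' := by
          rintro γ γ' ⟨l, hl, h1⟩ ⟨l', hl', h2⟩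
          exact ⟨l * l', mul_mem hl hl', fun w => by rw [Perm.mul_apply, h2, h1]; rfl⟩
        inv_mem' := by
          rintro γ ⟨l, hl, h1⟩
          exact ⟨l⁻¹, inv_mem hl, fun w => by rw [Perm.inv_eq_iff_eq, h1, app_inv]⟩ }
    refine hL M fun c hc z hz => ?_
    obtain ⟨r, ⟨u, hu, hur⟩, hr⟩ := exists_mem_Ahom hst ha hb haD hbD hc
    have h1 : ∀ w, (g * a * u) (cat (D 0) w) = cat e (cat s (cat r w)) := fun w => by
      rw [Perm.mul_apply, hur, Perm.mul_apply, haD, hgD]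
    have hgau : g * a * u ∈ Λ := mul_mem (mul_mem hg ha) hu
    refine ⟨(g * a * u)⁻¹ * φ z * (g * a * u),
      mul_mem (mul_mem (inv_mem hgau) (hφΛ z hz)) hgau, fun w => ?_⟩
    rw [Perm.mul_apply, h1, Perm.mul_apply, Perm.inv_eq_iff_eq, h1, hφe, Cn_cat, hr]
  have hN : ∀ γ ∈ Gam p, ∀ n ∈ Λ.comap (Cn (D 0)), γ * n * γ⁻¹ ∈ Λ.comap (Cn (D 0)) := by
    intro γ hγ n hn
    obtain ⟨l, hl, hlD⟩ := hM γ hγ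
    rw [Subgroup.mem_comap, ← conj_Cn' hlD]
    exact mul_mem (mul_mem hl hn) (inv_mem hl)
  have hsupp : ∀ u : Perm Pt, (∀ w, u (cat (D 0) w) = cat (D 0) w) →
      ∃ m, k * u * k⁻¹ = Cn (D 0) m := by
    intro u hu
    refine exists_eq_Cn fun z hz => ?_
    obtain ⟨w, hw⟩ : k⁻¹ z ∈ Cone (D 0) := by
      by_contra h1
      exact hz (by simpa only [app_inv] using hk _ h1)
    rw [Perm.mul_apply, Perm.mul_apply, ← hw, hu, hw, app_inv]
  have hD : Gam p ≤ Λ.comap (Cn (D 0)) := by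
    have hgb : g * b ∈ Λ := mul_mem hg hb
    obtain ⟨m, hm⟩ := hsupp ((g * b)⁻¹ * φ y * (g * b)) fun w => by
      rw [Perm.mul_apply, Perm.mul_apply, Perm.inv_eq_iff_eq, Perm.mul_apply, hbD, hgD, hφe,
        Cn_fix_cat hst.symm]
    have hmΛ : Cn (D 0) m ∈ Λ := by
      rw [← hm]
      exact mul_mem (mul_mem hkΛ (mul_mem (mul_mem (inv_mem hgb) hφy) hgb)) (inv_mem hkΛ)
    obtain ⟨θ, hθ⟩ : ∃ θ, θ = k * (g * b)⁻¹ := ⟨_, rfl⟩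
    have hθΛ : θ ∈ Λ := hθ ▸ mul_mem hkΛ (inv_mem hgb)
    have hmθ : Cn (D 0) m = θ * φ y * θ⁻¹ := by rw [← hm, hθ]; simp [mul_assoc]
    obtain ⟨d, hd⟩ := exists_cone_image (hΛ hθΛ) (D 0)
    have hmd : ∀ w, Cn (D 0) m (cat d w) ∉ Cone d := by
      rintro w ⟨w', hw'⟩
      obtain ⟨v, hv⟩ := hd w
      obtain ⟨v', hv'⟩ := hd w'
      rw [← hv, ← hv', hmθ, Perm.mul_apply, Perm.mul_apply, inv_app, hφD] at hw'
      exact cat_ne (inc_D hy0) _ _ (θ.injective hw').symm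
    have hd' : ¬ inc d (D 0) := by
      intro hi
      exact hmd default (by rw [Cn_fix_cat hi]; exact mem_cone _ _)
    obtain ⟨d', hd'⟩ : ∃ d', ∀ w, cat (D 0) (cat d' w) ∈ Cone d := by
      rcases prefix_of_not_inc hd' with ⟨r, hr⟩ | ⟨r, rfl⟩
      · exact ⟨[], fun w => by rw [hr, cat_append]; exact mem_cone _ _⟩
      · exact ⟨r, fun w => by rw [← cat_append]; exact mem_cone _ _⟩
    refine Gam_le_of_normalized hN (n := m) (c := d') hmΛ ?_
    rintro w ⟨w', hw'⟩
    obtain ⟨v, hv⟩ := hd' w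
    have h1 := hmd v
    rw [hv, Cn_cat, ← hw'] at h1
    exact h1 (hd' w')
  have hfix : ∀ γ ∈ Gam p, (∀ w, γ (cat (D 0) w) = cat (D 0) w) → γ ∈ Λ := by
    intro γ hγ hγD
    obtain ⟨m, hm⟩ := hsupp γ hγD
    have e1 : a * (k * γ * k⁻¹) * a⁻¹ = Cn (D 0 ++ s) m := by
      rw [hm]
      exact conj_Cn (fun w => by rw [haD, cat_append]) m
    have h1 : Cn (D 0 ++ s) m ∈ Gam p := by
      rw [← e1]
      exact mul_mem (mul_mem (hΛ ha) (mul_mem (mul_mem (hΛ hkΛ) hγ) (inv_mem (hΛ hkΛ))))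
        (inv_mem (hΛ ha))
    obtain ⟨v, hv, hvs⟩ := exists_Vg {()} (fun _ => D 0 ++ s) (fun _ => s) (D 1) t
      (by simp) (by simp) (by simp only [Finset.mem_singleton, forall_const]
                              exact (inc_D one_ne_zero).right s) (by simp [hst.symm])
    have h2 : Cn s m ∈ Gam p := by
      rw [← conj_Cn (hvs () (by simp)) m]
      exact mul_mem (mul_mem (Vg_le_Gam hv) h1) (inv_mem (Vg_le_Gam hv))
    have h3 := hD h2
    rw [Subgroup.mem_comap, Cn_Cn, ← e1] at h3
    have h4 := mul_mem (mul_mem (inv_mem hkΛ) (mul_mem (mul_mem (inv_mem ha) h3) ha)) hkΛ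
    simpa [mul_assoc] using h4
  refine Gam_le_of_fix (inc_D hy0) (he.right _) (he.right _) (fun γ hγ hγy => ?_) hfix
  have h1 : (φ y)⁻¹ * γ * φ y ∈ Λ := by
    refine hfix _ (mul_mem (mul_mem (inv_mem (hΛ hφy)) hγ) (hΛ hφy)) fun w => ?_
    rw [Perm.mul_apply, Perm.mul_apply, hφD, hγy, Perm.inv_eq_iff_eq, hφD]
  have h2 := mul_mem (mul_mem hφy h1) (inv_mem hφy)
  simpa [mul_assoc] using h2

end
/-- The word of the cone that receives the images of the points outside `D 0`. -/
def zw (j : ℕ) : List Bool := true :: num j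

/-- The word of the first half of the exceptional cone `num (l + 1)`. -/
def sl (l : ℕ) : List Bool := num (l + 1) ++ [false]

/-- The word of the second half of the exceptional cone `num (l + 1)`. -/
def tl (l : ℕ) : List Bool := num (l + 1) ++ [true]

/-- The word of the image of the cone `zw j` under the marked element of the `l`-th group. -/
def aw (X : ℕ → ℕ) (l j : ℕ) : List Bool :=
  zw l ++ (true :: (num (X l) ++ (true :: num (j - l - 1))))

/-- The word of the `Z j`-th piece inside the cone `aw X l j`. -/
def hw (X Z : ℕ → ℕ) (l j : ℕ) : List Bool := aw X l j ++ (true :: num (Z j))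

/-- The word of the `Y j`-th piece inside the cone `aw X l j`. -/
def yw (X Y : ℕ → ℕ) (l j : ℕ) : List Bool := aw X l j ++ (true :: num (Y j))

theorem inc_sl_tl (l : ℕ) : inc (sl l) (tl l) := by simp [sl, tl, inc_append_left]

theorem inc_zw {i j : ℕ} (h : i ≠ j) : inc (zw i) (zw j) := by simpa [zw] using inc_num h

/-- The prescribed values of the conjugating element that places the `j`-th group relative to the
earlier ones. -/
structure IsSpread (X Y Z : ℕ → ℕ) (j : ℕ) (v : Perm Pt) : Prop where
  left : ∀ w, v (cat [true, false] w) = cat (zw j ++ [true]) w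
  rest : ∀ w, v (cat (List.replicate (j + 1) false) w) = cat (zw j ++ [false]) w
  one : ∀ w, v (cat [true, true, true] w) = cat (true :: List.replicate (j + 1) false) w
  exc : ∀ l < j, ∀ w, v (cat (num (l + 1)) w) = cat (yw X Y l j ++ tl l) w
  fst : ∀ l < j, ∀ w, v (cat (D 0 ++ sl l) w) = cat (hw X Z l j) w
  snd : ∀ l < j, ∀ w, v (cat (D 0 ++ tl l) w) = cat (yw X Y l j ++ sl l) w

/-- The source words in the definition of `IsSpread`. -/
def src (j : ℕ) : Fin 3 ⊕ Fin 3 × Fin j → List Bool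
  | .inl 0 => [true, false]
  | .inl 1 => List.replicate (j + 1) false
  | .inl 2 => [true, true, true]
  | .inr (0, l) => num (l + 1)
  | .inr (1, l) => D 0 ++ sl l
  | .inr (2, l) => D 0 ++ tl l

/-- The target words in the definition of `IsSpread`. -/
def tgt (X Y Z : ℕ → ℕ) (j : ℕ) : Fin 3 ⊕ Fin 3 × Fin j → List Bool
  | .inl 0 => zw j ++ [true]
  | .inl 1 => zw j ++ [false]
  | .inl 2 => true :: List.replicate (j + 1) false
  | .inr (0, l) => yw X Y l j ++ tl l
  | .inr (1, l) => hw X Z l j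
  | .inr (2, l) => yw X Y l j ++ sl l

theorem inc_num_append {l l' : ℕ} (h : l ≠ l') (c d : List Bool) :
    inc (num l ++ c) (num l' ++ d) := (inc_num h).append_right c d

theorem inc_replicate_num {l j : ℕ} (h : l < j) (c : List Bool) :
    inc (List.replicate j false) (num l ++ c) := (inc_num_replicate h).symm.right c

theorem inc_src (j : ℕ) (i k : Fin 3 ⊕ Fin 3 × Fin j) (h : i ≠ k) : inc (src j i) (src j k) := by
  have h1 : ∀ l : Fin j, inc (num l) (List.replicate j false) := fun l =>
    inc_num_replicate l.2
  have h2 : ∀ l l' : Fin j, l ≠ l' → inc (num l) (num l') := fun l l' h => inc_num (by omega)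
  have h3 : ∀ l l' : Fin j, l ≠ l' → ∀ c d, inc (num l ++ c) (num l' ++ d) := fun l l' h =>
    inc_num_append (by omega)
  rcases i with i | ⟨i, l⟩ <;> rcases k with k | ⟨k, l'⟩ <;> fin_cases i <;> fin_cases k <;>
    simp at h <;>
    simp [src, D, sl, tl, num_zero, num_succ, List.replicate_succ, h1, (h1 _).symm, h2, h3, h] <;>
    (rcases eq_or_ne l l' with rfl | hl
     · simp
     · exact h3 _ _ hl _ _)

theorem inc_src_out (j : ℕ) (i : Fin 3 ⊕ Fin 3 × Fin j) :
    inc (true :: true :: List.replicate (j + 1) false) (src j i) := by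
  rcases i with i | ⟨i, l⟩ <;> fin_cases i <;>
    simp [src, D, sl, tl, num_zero, num_succ, List.replicate_succ, inc_replicate_num]

theorem inc_tgt_out (X Y Z : ℕ → ℕ) (j : ℕ) (i : Fin 3 ⊕ Fin 3 × Fin j) :
    inc [false] (tgt X Y Z j i) := by
  rcases i with i | ⟨i, l⟩ <;> fin_cases i <;> simp [tgt, zw, aw, yw, hw]

theorem inc_tgt {X Y Z : ℕ → ℕ} {j : ℕ} (hj : 0 < j → Y j ≠ Z j) (i k : Fin 3 ⊕ Fin 3 × Fin j)
    (h : i ≠ k) : inc (tgt X Y Z j i) (tgt X Y Z j k) := by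
  have h3 : ∀ l l' : Fin j, l ≠ l' → ∀ c d, inc (num l ++ c) (num l' ++ d) := fun l l' h =>
    inc_num_append (by omega)
  have h4 : ∀ l : Fin j, ∀ c, inc (num j) (num l ++ c) := fun l c => (inc_num (by omega)).right c
  have h5 : ∀ l : Fin j, ∀ c d, inc (num j ++ c) (num l ++ d) := fun l c =>
    inc_num_append (by omega) c
  have h6 : ∀ c, inc (num j ++ c) (List.replicate (j + 1) false) := fun c =>
    (inc_num_replicate (by omega)).left c
  have h7 : ∀ l : Fin j, ∀ c, inc (List.replicate (j + 1) false) (num l ++ c) := fun l c =>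
    inc_replicate_num (by omega) c
  have h9 : ∀ l : Fin j, ∀ d, inc (num (Z j)) (num (Y j) ++ d) := fun l =>
    (inc_num (hj l.pos).symm).right
  rcases i with i | ⟨i, l⟩ <;> rcases k with k | ⟨k, l'⟩ <;> fin_cases i <;> fin_cases k <;>
    simp at h <;>
    simp only [tgt, zw, aw, yw, hw, sl, tl, List.append_assoc, List.cons_append, inc_cons,
      inc_append_left, ne_eq, not_true, false_or] <;>
    first
    | simp
    | exact h6 _
    | exact (h6 _).symm | exact h4 _ _ | exact h5 _ _ _ | exact h7 _ _
    | exact (h4 _ _).symm | exact (h5 _ _ _).symm | exact (h7 _ _).symm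
    | exact h3 _ _ h _ _
    | (rcases eq_or_ne l l' with rfl | hl
       · simp [h9 l, (h9 l _).symm]
       · exact h3 _ _ hl _ _)

theorem exists_isSpread {X Y Z : ℕ → ℕ} {j : ℕ} (hj : 0 < j → Y j ≠ Z j) :
    ∃ v ∈ Vg, IsSpread X Y Z j v := by
  obtain ⟨v, hv, h⟩ := exists_Vg Finset.univ (src j) (tgt X Y Z j) _ _
    (fun i _ k _ => inc_src j i k) (fun i _ k _ => inc_tgt hj i k) (fun i _ => inc_src_out j i)
    (fun i _ => inc_tgt_out X Y Z j i)
  have h' : ∀ i w, v (cat (src j i) w) = cat (tgt X Y Z j i) w := fun i => h i (Finset.mem_univ i)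
  exact ⟨v, hv, h' (.inl 0), h' (.inl 1), h' (.inl 2), fun l hl => h' (.inr (0, ⟨l, hl⟩)),
    fun l hl => h' (.inr (1, ⟨l, hl⟩)), fun l hl => h' (.inr (2, ⟨l, hl⟩))⟩

/-- The action of permutations on the cone `num 0` together with copies of the action `Ahom` in the
exceptional cones `num (l + 1)` for `l < j`. -/
noncomputable def phi0 (L : List (Perm Pt)) (j : ℕ) : Perm ℕ →* Perm Pt :=
  Th.comp (MonoidHom.pi fun
    | 0 => io
    | l + 1 => if l < j then (Cn (sl l)).comp (Ahom (sl l) (tl l) (inc_sl_tl l) L) else 1)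

theorem phi0_zero (L : List (Perm Pt)) (j : ℕ) (g : Perm ℕ) (w : Pt) :
    phi0 L j g (cat (num 0) w) = cat (num 0) (io g w) := by
  rw [cat_num, cat_num, phi0, MonoidHom.comp_apply, Th_cons]
  rfl

theorem phi0_succ (L : List (Perm Pt)) {l j : ℕ} (hl : l < j) (g : Perm ℕ) (w : Pt) :
    phi0 L j g (cat (num (l + 1)) w) =
      cat (num (l + 1)) (Cn (sl l) (Ahom (sl l) (tl l) (inc_sl_tl l) L g) w) := by
  rw [cat_num, cat_num, phi0, MonoidHom.comp_apply, Th_cons]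
  simp [hl]

theorem phi0_D (L : List (Perm Pt)) (j : ℕ) (g : Perm ℕ) (n : ℕ) (w : Pt) :
    phi0 L j g (cat (D n) w) = cat (D (g n)) w := by
  rw [D, cat_append, phi0_zero, io_num, D, cat_append]

theorem Th_mem_of_finite {N : Subgroup (Perm Pt)} {k : ℕ → Perm Pt} (m : ℕ)
    (hk : ∀ n, m ≤ n → k n = 1) (hN : ∀ n, Cn (num n) (k n) ∈ N) : Th k ∈ N := by
  induction m generalizing k with
  | zero =>
    rw [show k = 1 from funext fun n => hk n (Nat.zero_le n), map_one]
    exact one_mem _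
  | succ m ih =>
    have e : k = Pi.mulSingle m (k m) * Function.update k m 1 := by
      ext1 n
      rcases eq_or_ne n m with rfl | h <;> simp [*]
    rw [e, map_mul, ← Cn_num_eq_Th]
    refine mul_mem (hN m) (ih (fun n hn => ?_) fun n => ?_)
    · rcases eq_or_ne n m with rfl | h
      · simp
      · rw [Function.update_of_ne h]
        exact hk n (by omega)
    · rcases eq_or_ne n m with rfl | h
      · simp
      · rw [Function.update_of_ne h]
        exact hN n

theorem phi0_mem {p : ℕ → Perm ℕ} {L : List (Perm Pt)} (j : ℕ) (hL : ∀ c ∈ L, c ∈ Gam p)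
    {g : Perm ℕ} (hg : Cn [true] (io g) ∈ Gam p) : phi0 L j g ∈ Gam p := by
  refine Th_mem_of_finite (j + 1) (fun n hn => ?_) fun n => ?_
  · cases n with
    | zero => omega
    | succ l => simp [show ¬ l < j by omega]
  · cases n with
    | zero => exact hg
    | succ l =>
      by_cases hl : l < j
      · simp only [MonoidHom.pi_apply, hl, if_true, MonoidHom.comp_apply]
        exact Cn_mem_Gam _ (Cn_mem_Gam _ (Ahom_mem _ hL hg))
      · simp [hl]

/-- The conjugate of `phi0` by `v`. -/
noncomputable def phi (v : Perm Pt) (L : List (Perm Pt)) (j : ℕ) : Perm ℕ →* Perm Pt :=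
  (MulAut.conj v).toMonoidHom.comp (phi0 L j)

theorem phi_eq (v : Perm Pt) (L : List (Perm Pt)) (j : ℕ) (g : Perm ℕ) :
    phi v L j g = v * phi0 L j g * v⁻¹ := rfl

theorem phi_apply (v : Perm Pt) (L : List (Perm Pt)) (j : ℕ) (g : Perm ℕ) (u : Pt) :
    phi v L j g (v u) = v (phi0 L j g u) := by
  rw [phi_eq, Perm.mul_apply, Perm.mul_apply, inv_app]

theorem phi_mem {p : ℕ → Perm ℕ} {v : Perm Pt} {L : List (Perm Pt)} (hv : v ∈ Vg) (j : ℕ)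
    (hL : ∀ c ∈ L, c ∈ Gam p) {g : Perm ℕ} (hg : Cn [true] (io g) ∈ Gam p) :
    phi v L j g ∈ Gam p :=
  mul_mem (mul_mem (Vg_le_Gam hv) (phi0_mem j hL hg)) (inv_mem (Vg_le_Gam hv))

/-- Each element `c` of a suitable finite list conjugates the elementary copy of `G` in such a way
that all the conjugates together generate. -/
theorem exists_list {p : ℕ → Perm ℕ} {G : Subgroup (Perm ℕ)} (hG : ∀ g ∈ G, g 0 = 0 → g = 1)
    {x : Perm ℕ} (hx : x ∈ G) (hx1 : x ≠ 1) :
    ∃ L : List (Perm Pt), (∀ c ∈ L, c ∈ Gam p) ∧ ∀ N : Subgroup (Perm Pt),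
      (∀ c ∈ L, ∀ g ∈ G, c * Cn [true] (io g) * c⁻¹ ∈ N) → Gam p ≤ N := by
  have key : Gam p ≤
      Subgroup.closure {u | ∃ c ∈ Gam p, ∃ g ∈ G, u = c * Cn [true] (io g) * c⁻¹} := by
    refine Gam_le_of_normalized (c := D 0) (n := Cn [true] (io x)) (fun γ hγ n hn => ?_)
      (Subgroup.subset_closure ⟨1, one_mem _, x, hx, by simp⟩) fun w => ?_
    · induction hn using Subgroup.closure_induction with
      | mem u hu =>
        obtain ⟨c, hc, g, hg, rfl⟩ := hu
        exact Subgroup.subset_closure ⟨γ * c, mul_mem hγ hc, g, hg, by simp [mul_assoc]⟩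
      | one => simp
      | mul a b _ _ ha hb => simpa [mul_assoc] using mul_mem ha hb
      | inv a _ ha => simpa [mul_assoc] using inv_mem ha
    · rw [show D 0 = [true] ++ num 0 from rfl, cat_append, Cn_cat, io_num, ← cat_append]
      exact notMem_cone (inc_D fun h => hx1 (hG x hx h)) w
  have fin : ∀ u ∈ Subgroup.closure {u | ∃ c ∈ Gam p, ∃ g ∈ G, u = c * Cn [true] (io g) * c⁻¹},
      ∃ L : List (Perm Pt), (∀ c ∈ L, c ∈ Gam p) ∧ ∀ N : Subgroup (Perm Pt),
      (∀ c ∈ L, ∀ g ∈ G, c * Cn [true] (io g) * c⁻¹ ∈ N) → u ∈ N := by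
    intro u hu
    induction hu using Subgroup.closure_induction with
    | mem u hu =>
      obtain ⟨c, hc, g, hg, rfl⟩ := hu
      exact ⟨[c], by simpa using hc, fun N h => h c (by simp) g hg⟩
    | one => exact ⟨[], by simp, fun N _ => one_mem _⟩
    | mul a b _ _ ha hb =>
      obtain ⟨L, hL, h⟩ := ha
      obtain ⟨L', hL', h'⟩ := hb
      refine ⟨L ++ L', fun c hc => (List.mem_append.1 hc).elim (hL c) (hL' c), fun N hN => ?_⟩
      exact mul_mem (h N fun c hc => hN c (by simp [hc])) (h' N fun c hc => hN c (by simp [hc]))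
    | inv a _ ha =>
      obtain ⟨L, hL, h⟩ := ha
      exact ⟨L, hL, fun N hN => inv_mem (h N hN)⟩
  obtain ⟨T, hT, hTG⟩ := Gam_fg (p := p)
  choose! L hL hLN using fun u hu => fin u (key hu)
  refine ⟨hT.toFinset.toList.flatMap L, fun c hc => ?_, fun N hN => ?_⟩
  · simp only [List.mem_flatMap, Finset.mem_toList, Set.Finite.mem_toFinset] at hc
    obtain ⟨u, hu, hc⟩ := hc
    exact hL u (hTG ▸ Subgroup.subset_closure hu) c hc
  · rw [← hTG, Subgroup.closure_le]
    intro u hu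
    refine hLN u (hTG ▸ Subgroup.subset_closure hu) N fun c hc => hN c ?_
    simp only [List.mem_flatMap, Finset.mem_toList, Set.Finite.mem_toFinset]
    exact ⟨u, hu, hc⟩

theorem cat_D_of_ne {n : ℕ} (h : n ≠ 0) (w : Pt) :
    cat (D n) w = cat [true, false] (cat (num (n - 1)) w) := by
  obtain ⟨n, rfl⟩ := Nat.exists_eq_succ_of_ne_zero h
  rfl

theorem num_add (n m : ℕ) : num (n + m) = List.replicate m false ++ num n := by
  induction m with
  | zero => rfl
  | succ m ih => rw [← add_assoc, num_succ, ih]; rfl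

theorem cone_cases (j : ℕ) {u : Pt} (hu : u ∉ Cone (D 0)) : u ∈ Cone [true, false] ∨
    u ∈ Cone (List.replicate (j + 1) false) ∨ ∃ l < j, u ∈ Cone (num (l + 1)) := by
  obtain ⟨n, w, rfl⟩ := cons_surj u
  rcases n with _ | n
  · obtain ⟨b, w, rfl⟩ := bit_surj w
    cases b
    · exact Or.inl ⟨w, rfl⟩
    · exact absurd ⟨w, rfl⟩ hu
  · rcases lt_or_ge n j with h | h
    · exact Or.inr (Or.inr ⟨n, h, w, cat_num _ _⟩)
    · refine Or.inr (Or.inl ⟨cons (n - j) w, ?_⟩)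
      rw [cat_replicate]
      congr 1
      omega

section
variable {X Y Z : ℕ → ℕ} {i j : ℕ} {v : Perm Pt} {L : List (Perm Pt)}

theorem IsSpread.cases (hv : IsSpread X Y Z j v) {r : Pt} (hr : v⁻¹ r ∉ Cone (D 0)) :
    r ∈ Cone (zw j) ∨ ∃ l < j, v⁻¹ r ∈ Cone (num (l + 1)) ∧ r ∈ Cone (yw X Y l j) := by
  obtain ⟨u, rfl⟩ := v.surjective r
  rw [inv_app] at hr ⊢
  rcases cone_cases j hr with ⟨w, rfl⟩ | ⟨w, rfl⟩ | ⟨l, hl, w, rfl⟩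
  · rw [hv.left, cat_append]
    exact Or.inl (mem_cone _ _)
  · rw [hv.rest, cat_append]
    exact Or.inl (mem_cone _ _)
  · rw [hv.exc l hl]
    exact Or.inr ⟨l, hl, mem_cone _ _, by rw [cat_append]; exact mem_cone _ _⟩

theorem IsSpread.phi_apply (hv : IsSpread X Y Z j v) {g : Perm ℕ} (hg : g 0 ≠ 0) {r : Pt}
    (hr : v⁻¹ r ∈ Cone (D 0)) : phi v L j g r ∈ Cone (zw j) := by
  obtain ⟨u, rfl⟩ := v.surjective r
  rw [inv_app] at hr
  obtain ⟨w, rfl⟩ := hr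
  rw [EmbSimple.phi_apply, phi0_D, cat_D_of_ne hg, hv.left, cat_append]
  exact mem_cone _ _

theorem IsSpread.phi_zw (hv : IsSpread X Y Z i v) (hij : i < j) {g : Perm ℕ} (hg : g 0 ≠ 0)
    (hX : X i = g 0 - 1) (w : Pt) : phi v L i g (cat (zw j) w) = cat (aw X i j) w := by
  have h1 : cat (zw j) w = v (cat (D 0) (cat [true] (cat (num (j - i - 1)) w))) := by
    obtain ⟨k, rfl⟩ := Nat.exists_eq_add_of_lt hij
    rw [show cat (D 0) (cat [true] (cat (num (i + k + 1 - i - 1)) w)) =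
      cat [true, true, true] (cat (num (i + k + 1 - i - 1)) w) from rfl, hv.one, zw, cat_cons,
      cat_cons, ← cat_append]
    rw [show i + k + 1 - i - 1 = k by omega, show i + k + 1 = k + (i + 1) by omega, num_add]
  rw [h1, EmbSimple.phi_apply, phi0_D, cat_D_of_ne hg, hv.left, aw, hX]
  simp only [cat_append, cat_cons]
  rfl

end

theorem Gam_le_of_phi {p : ℕ → Perm ℕ} {G : Subgroup (Perm ℕ)} {X Y Z : ℕ → ℕ} {i j : ℕ}
    (hij : i < j) {v v' : Perm Pt} (hv : IsSpread X Y Z i v) (hv' : IsSpread X Y Z j v')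
    (hvV : v' ∈ Vg) {Λ : Subgroup (Perm Pt)} (hΛ : Λ ≤ Gam p)
    (hG : ∀ g ∈ G, g 0 = 0 → g = 1) {L L' : List (Perm Pt)}
    (hL : ∀ N : Subgroup (Perm Pt),
      (∀ c ∈ L', ∀ g ∈ G, c * Cn [true] (io g) * c⁻¹ ∈ N) → Gam p ≤ N)
    (hφ : ∀ g ∈ G, phi v' L' j g ∈ Λ) {x y h h' : Perm ℕ} (hx : phi v L i x ∈ Λ) (hx0 : x 0 ≠ 0)
    (hyG : y ∈ G) (hhG : h ∈ G) (hy : y ≠ 1) (hh : h ≠ 1) (hhy : h ≠ y)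
    (hcase : (y * y ≠ 1 ∧ h = y⁻¹ ∧ h' = y) ∨ (h * y ≠ 1 ∧ h' = h))
    (hX : X i = x 0 - 1) (hY : Y j = y 0 - 1) (hZ : Z j = h 0 - 1) : Gam p ≤ Λ := by
  have hV := Vg_le_Gam (p := p) hvV
  have hx0' : x⁻¹ 0 ≠ 0 := fun e => hx0 (by rw [Perm.inv_eq_iff_eq] at e; exact e.symm)
  have hy0 : y 0 ≠ 0 := fun e => hy (hG y hyG e)
  have hh0 : h 0 ≠ 0 := fun e => hh (hG h hhG e)
  obtain ⟨ξ, hξ⟩ : ∃ ξ, ξ = v'⁻¹ * phi v L i x * v' := ⟨_, rfl⟩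
  have hξa : ∀ q, v' (ξ q) = phi v L i x (v' q) := fun q => by
    rw [hξ, Perm.mul_apply, Perm.mul_apply, app_inv]
  have hξi : ∀ q, v' (ξ⁻¹ q) = phi v L i x⁻¹ (v' q) := fun q => by
    rw [map_inv, Perm.eq_inv_iff_eq, ← hξa, app_inv]
  -- the set of points outside both cones is moved into the complement of the first support
  have hpos : ∀ q, q ∉ Cone (D 0) → q ∉ Cone (num (i + 1)) → v⁻¹ (v' q) ∈ Cone (D 0) := by
    intro q h1 h2
    by_contra h3
    rcases hv'.cases (r := v' q) (by rwa [inv_app]) with h4 | ⟨l, hl, h4, h5⟩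
    · rcases hv.cases h3 with h6 | ⟨l', hl', -, h7⟩
      · obtain ⟨w, hw⟩ := h4
        rw [← hw] at h6
        exact notMem_cone (inc_zw hij.ne') _ h6
      · obtain ⟨w, hw⟩ := h4
        rw [← hw] at h7
        refine notMem_cone ?_ _ h7
        simpa only [yw, aw, List.append_assoc] using (inc_zw (show j ≠ l' by omega)).right _
    · have hli : l ≠ i := by
        rintro rfl
        rw [inv_app] at h4
        exact h2 h4
      rcases hv.cases h3 with h6 | ⟨l', hl', -, h7⟩
      · obtain ⟨w, hw⟩ := h5
        rw [← hw] at h6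
        refine notMem_cone ?_ _ h6
        simpa only [yw, aw, List.append_assoc] using (inc_zw hli).left _
      · obtain ⟨w, hw⟩ := h5
        rw [← hw] at h7
        refine notMem_cone ?_ _ h7
        rcases eq_or_ne l l' with rfl | hll
        · simp only [yw, aw, List.append_assoc, List.cons_append, inc_append_left, inc_cons]
          exact Or.inr (Or.inr (inc_num_append (by omega) _ _))
        · simpa only [yw, aw, List.append_assoc] using (inc_zw hll).append_right _ _
  have hsmall : ∀ q, v' q ∈ Cone (zw i) → q ∈ Cone (D 0) ∨ q ∈ Cone (num (i + 1)) := by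
    intro q hq
    by_contra! h
    rcases hv'.cases (r := v' q) (by rw [inv_app]; exact h.1) with h4 | ⟨l, hl, h4, h5⟩
    · obtain ⟨w, hw⟩ := h4
      rw [← hw] at hq
      exact notMem_cone (inc_zw hij.ne') _ hq
    · have hli : l ≠ i := by
        rintro rfl
        rw [inv_app] at h4
        exact h.2 h4
      obtain ⟨w, hw⟩ := h5
      rw [← hw] at hq
      refine notMem_cone ?_ _ hq
      simpa only [yw, aw, List.append_assoc] using (inc_zw hli).left _
  have hD : ∀ n, n ≠ 0 → ∀ w, v' (cat (D n) w) =
      cat (zw j) (cat [true] (cat (num (n - 1)) w)) := fun n hn w => by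
    rw [cat_D_of_ne hn, hv'.left, cat_append]
  suffices hS : Gam p ≤ Λ.comap (MulAut.conj v').toMonoidHom by
    intro γ hγ
    have := hS (mul_mem (mul_mem (inv_mem hV) hγ) hV)
    rw [Subgroup.mem_comap] at this
    simpa [mul_assoc] using this
  refine Gam_le_of_pair (G := G) (e := num (i + 1)) (x := ξ) (φ := phi0 L' j) (y := y) (h := h)
    (h' := h') ?_ hG (by simp [num_succ]) (inc_sl_tl i) hL (fun g hg => hφ g hg) (phi0_D L' j)
    (phi0_succ L' hij) ?_ hyG hhG hy hh hhy hcase ?_ ?_ ?_ ?_ ?_ ?_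
  · intro u hu
    have := mul_mem (mul_mem (inv_mem hV) (hΛ hu)) hV
    simpa [mul_assoc] using this
  · rw [Subgroup.mem_comap, hξ]
    simpa [mul_assoc] using hx
  · intro q h1 h2
    refine hsmall _ ?_
    rw [hξa]
    exact hv.phi_apply hx0 (hpos q h1 h2)
  · intro q h1 h2
    refine hsmall _ ?_
    rw [hξi]
    exact hv.phi_apply hx0' (hpos q h1 h2)
  · intro w
    apply v'.injective
    rw [hξa, hD _ hh0, hv.phi_zw hij hx0 hX, ← cat_append (D 0), hv'.fst i hij, hw, hZ]
    simp only [cat_append, cat_cons, cat_nil]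
  · intro w
    apply v'.injective
    rw [hξa, hD _ hy0, hv.phi_zw hij hx0 hX, ← cat_append (D 0), hv'.snd i hij, yw, hY]
    simp only [cat_append, cat_cons, cat_nil]
  · intro w
    apply v'.injective
    rw [hξa, hD _ hy0, hv.phi_zw hij hx0 hX, hv'.exc i hij, yw, hY]
    simp only [cat_append, cat_cons, cat_nil]
  · intro q q' h1 h2 h3 h4 he
    have e1 : phi v L i x⁻¹ (v' q) = phi v L i x (v' q') := by rw [← hξa, ← hξi, he]
    obtain ⟨w, hw⟩ := hpos q h1 h2
    obtain ⟨w', hw'⟩ := hpos q' h3 h4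
    have hw := Perm.eq_inv_iff_eq.1 hw
    have hw' := Perm.eq_inv_iff_eq.1 hw'
    rw [← hw, ← hw', phi_apply, phi_apply, phi0_D, phi0_D] at e1
    have e2 := v.injective e1
    by_cases h0 : x⁻¹ 0 = x 0
    · rw [h0, cat_inj] at e2
      exact v'.injective (by rw [← hw, ← hw', e2])
    · exact absurd e2 (cat_ne (inc_D h0) _ _)

theorem phi_normal {p : ℕ → Perm ℕ} {v : Perm Pt} (hv : v ∈ Vg) {L : List (Perm Pt)} {j : ℕ}
    {g : Perm ℕ} (hg : g 0 ≠ 0) {N : Subgroup (Perm Pt)}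
    (hN : ∀ γ ∈ Gam p, ∀ n ∈ N, γ * n * γ⁻¹ ∈ N) (h : phi v L j g ∈ N) : Gam p ≤ N := by
  have hV := Vg_le_Gam (p := p) hv
  refine Gam_le_of_normalized hN (n := phi0 L j g) (c := D 0) ?_ fun w => ?_
  · simpa [phi_eq, mul_assoc] using hN _ (inv_mem hV) _ h
  · rw [phi0_D]
    exact notMem_cone (inc_D hg) w

theorem exists_case {G : Subgroup (Perm ℕ)}
    (h3 : ∃ y ∈ G, ∃ h ∈ G, y ≠ 1 ∧ h ≠ 1 ∧ h ≠ y) :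
    ∃ y h h' : Perm ℕ, y ∈ G ∧ h ∈ G ∧ y ≠ 1 ∧ h ≠ 1 ∧ h ≠ y ∧
      ((y * y ≠ 1 ∧ h = y⁻¹ ∧ h' = y) ∨ (h * y ≠ 1 ∧ h' = h)) := by
  obtain ⟨y, hy, h, hh, hy1, hh1, hhy⟩ := h3
  by_cases hyy : y * y = 1
  · refine ⟨y, h, h, hy, hh, hy1, hh1, hhy, Or.inr ⟨fun e => hhy ?_, rfl⟩⟩
    rw [← hyy] at e
    exact mul_right_cancel e
  · exact ⟨y, y⁻¹, y, hy, inv_mem hy, hy1, by simpa using hy1,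
      fun e => hyy (by rw [← inv_eq_iff_mul_eq_one, e]), Or.inl ⟨hyy, rfl, rfl⟩⟩

theorem exists_copies {p : ℕ → Perm ℕ} {G : ℕ → Subgroup (Perm ℕ)}
    (hG : ∀ j, ∀ g ∈ G j, g 0 = 0 → g = 1) (hGp : ∀ j, ∀ g ∈ G j, Cn [true] (io g) ∈ Gam p)
    {x : ℕ → Perm ℕ} (hx : ∀ j, x j ∈ G j) (hx1 : ∀ j, x j ≠ 1)
    (h3 : ∀ j, 0 < j → ∃ y ∈ G j, ∃ h ∈ G j, y ≠ 1 ∧ h ≠ 1 ∧ h ≠ y) :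
    ∃ Φ : ℕ → Perm ℕ →* Perm Pt, (∀ j, ∀ g ∈ G j, Φ j g ∈ Gam p) ∧
      (∀ i j, i < j → ∀ Λ ≤ Gam p, Φ i (x i) ∈ Λ → (∀ g ∈ G j, Φ j g ∈ Λ) → Gam p ≤ Λ) ∧
      ∀ j, ∀ g ∈ G j, g ≠ 1 → ∀ N : Subgroup (Perm Pt),
        (∀ γ ∈ Gam p, ∀ n ∈ N, γ * n * γ⁻¹ ∈ N) → Φ j g ∈ N → Gam p ≤ N := by
  choose! y h h' hyG hhG hy hh hhy hcase using fun j hj => exists_case (h3 j hj)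
  choose L hLp hL using fun j => exists_list (p := p) (hG j) (hx j) (hx1 j)
  have h0 : ∀ j, ∀ g ∈ G j, g ≠ 1 → g 0 ≠ 0 := fun j g hg h1 e => h1 (hG j g hg e)
  have hYZ : ∀ j, 0 < j → y j 0 - 1 ≠ h j 0 - 1 := by
    intro j hj e
    have e' : y j 0 = h j 0 := by
      have := h0 j _ (hyG j hj) (hy j hj)
      have := h0 j _ (hhG j hj) (hh j hj)
      omega
    have := hG j ((h j)⁻¹ * y j) (mul_mem (inv_mem (hhG j hj)) (hyG j hj))
      (by rw [Perm.mul_apply, e', inv_app])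
    exact hhy j hj (inv_mul_eq_one.1 this)
  choose v hvV hv using fun j => exists_isSpread (X := fun j => x j 0 - 1)
    (Y := fun j => y j 0 - 1) (Z := fun j => h j 0 - 1) (hYZ j)
  refine ⟨fun j => phi (v j) (L j) j, fun j g hg => phi_mem (hvV j) j (hLp j) (hGp j g hg), ?_,
    fun j g hg hg1 N hN hgN => phi_normal (hvV j) (h0 j g hg hg1) hN hgN⟩
  intro i j hij Λ hΛ hxΛ hGΛ
  have hj : 0 < j := by omega
  exact Gam_le_of_phi hij (hv i) (hv j) (hvV j) hΛ (hG j) (hL j) hGΛ hxΛ (h0 i _ (hx i) (hx1 i))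
    (hyG j hj) (hhG j hj) (hy j hj) (hh j hj) (hhy j hj) (hcase j hj) rfl rfl rfl

theorem exists_simple_quotient {Γ : Type} [Group Γ] {a : Γ} (ha : a ≠ 1)
    (h : ∀ N : Subgroup Γ, N.Normal → a ∈ N → N = ⊤) :
    ∃ (M : Subgroup Γ) (_ : M.Normal), a ∉ M ∧ IsSimpleGroup (Γ ⧸ M) := by
  obtain ⟨M, -, hM⟩ := zorn_le_nonempty₀ {N : Subgroup Γ | N.Normal ∧ a ∉ N} (by
    intro c hc hch N hN
    refine ⟨sSup c, ⟨?_, fun hmem => ?_⟩, fun z hz => le_sSup hz⟩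
    · refine ⟨fun n hn g => ?_⟩
      obtain ⟨K, hK, hnK⟩ := (Subgroup.mem_sSup_of_directedOn ⟨N, hN⟩ hch.directedOn).1 hn
      exact (Subgroup.mem_sSup_of_directedOn ⟨N, hN⟩ hch.directedOn).2
        ⟨K, hK, (hc hK).1.conj_mem n hnK g⟩
    · obtain ⟨K, hK, haK⟩ := (Subgroup.mem_sSup_of_directedOn ⟨N, hN⟩ hch.directedOn).1 hmem
      exact (hc hK).2 haK) ⊥ ⟨inferInstance, by simpa using ha⟩
  have hn : M.Normal := hM.prop.1
  have hnt : Nontrivial (Γ ⧸ M) := ⟨a, 1, by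
    rw [Ne, QuotientGroup.eq_one_iff]
    exact hM.prop.2⟩
  refine ⟨M, hn, hM.prop.2, { eq_bot_or_eq_top_of_normal := fun K hK => ?_ }⟩
  by_cases haK : a ∈ K.comap (QuotientGroup.mk' M)
  · right
    have e := h _ inferInstance haK
    rw [eq_top_iff]
    rintro q -
    obtain ⟨b, rfl⟩ := QuotientGroup.mk'_surjective M q
    exact e.ge (Subgroup.mem_top b)
  · left
    have hle : K.comap (QuotientGroup.mk' M) ≤ M :=
      hM.le_of_ge ⟨inferInstance, haK⟩ fun m hm => by
        rw [Subgroup.mem_comap, QuotientGroup.mk'_apply, (QuotientGroup.eq_one_iff m).2 hm]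
        exact one_mem K
    rw [eq_bot_iff]
    rintro q hq
    obtain ⟨b, rfl⟩ := QuotientGroup.mk'_surjective M q
    exact (QuotientGroup.eq_one_iff b).2 (hle hq)

theorem exists_simple {p : ℕ → Perm ℕ} {G : ℕ → Subgroup (Perm ℕ)}
    (hG : ∀ j, ∀ g ∈ G j, g 0 = 0 → g = 1) (hGp : ∀ j, ∀ g ∈ G j, Cn [true] (io g) ∈ Gam p)
    {x : ∀ j, G j} (hx1 : ∀ j, x j ≠ 1)
    (h3 : ∀ j, 0 < j → ∃ y ∈ G j, ∃ h ∈ G j, y ≠ 1 ∧ h ≠ 1 ∧ h ≠ y) :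
    ∃ (S : Type) (_ : Group S), IsSimpleGroup S ∧ ∃ Ψ : ∀ j, G j →* S,
      (∀ j, Function.Injective (Ψ j)) ∧
      ∀ i j, i < j → ∀ Λ : Subgroup S, Ψ i (x i) ∈ Λ → (∀ g, Ψ j g ∈ Λ) → Λ = ⊤ := by
  obtain ⟨Φ, hΦ, hpair, hnorm⟩ := exists_copies hG hGp (x := fun j => x j) (fun j => (x j).2)
    (fun j e => hx1 j (Subtype.ext e)) h3
  let F : ∀ j, G j →* Gam p := fun j =>
    ((Φ j).comp (G j).subtype).codRestrict (Gam p) fun g => hΦ j g g.2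
  have key : ∀ j g, g ≠ 1 → ∀ N : Subgroup (Gam p), N.Normal → F j g ∈ N → N = ⊤ := by
    intro j g hg N hN hgN
    have := hnorm j g g.2 (fun e => hg (Subtype.ext e)) (N.map (Gam p).subtype) (by
      rintro γ hγ _ ⟨n, hn, rfl⟩
      exact ⟨⟨γ, hγ⟩ * n * ⟨γ, hγ⟩⁻¹, hN.conj_mem n hn _, rfl⟩) ⟨_, hgN, rfl⟩
    rw [eq_top_iff]
    rintro γ -
    obtain ⟨n, hn, e⟩ := this γ.2
    rwa [← Subtype.ext e]
  have hF : ∀ j g, g ≠ 1 → F j g ≠ 1 := by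
    intro j g hg e
    have h1 := key j g hg ⊥ inferInstance (by simp [e])
    have h2 : (⟨sw [false] [true], Vg_le_Gam (sw_mem_Vg (by simp))⟩ : Gam p) ∈
      (⊥ : Subgroup (Gam p)) := h1 ▸ Subgroup.mem_top _
    have h3 : sw [false] [true] = 1 := congrArg Subtype.val (Subgroup.mem_bot.1 h2)
    have h4 := sw_left (a := [false]) (b := [true]) (by simp) default
    rw [h3, Perm.one_apply] at h4
    exact cat_ne (by simp) _ _ h4
  obtain ⟨M, hM, haM, hS⟩ := exists_simple_quotient (hF 0 (x 0) (hx1 0)) (key 0 (x 0) (hx1 0))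
  refine ⟨Gam p ⧸ M, inferInstance, hS, fun j => (QuotientGroup.mk' M).comp (F j), fun j => ?_, ?_⟩
  · rw [injective_iff_map_eq_one]
    intro g hg
    by_contra hg1
    have := key j g hg1 M hM ((QuotientGroup.eq_one_iff _).1 hg)
    exact haM (this ▸ Subgroup.mem_top _)
  · intro i j hij Λ hi hj
    have := hpair i j hij ((Λ.comap (QuotientGroup.mk' M)).map (Gam p).subtype)
      (Subgroup.map_subtype_le _) ⟨_, hi, rfl⟩ fun g hg => ⟨_, hj ⟨g, hg⟩, rfl⟩
    rw [eq_top_iff]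
    rintro q -
    obtain ⟨γ, rfl⟩ := QuotientGroup.mk'_surjective M q
    obtain ⟨n, hn, e⟩ := this γ.2
    rw [← Subtype.ext e]
    exact hn

/-- The action of sequences of group elements on `H × ℤ` by left translation in every layer. -/
def layerHom (H : Type*) [Group H] : (ℤ → H) →* Perm (H × ℤ) where
  toFun f :=
    { toFun := fun q => (f q.2 * q.1, q.2)
      invFun := fun q => ((f q.2)⁻¹ * q.1, q.2)
      left_inv := fun q => by simp
      right_inv := fun q => by simp }
  map_one' := by ext q <;> simp
  map_mul' f f' := by ext q <;> simp [mul_assoc]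

/-- Every element of a countable group becomes a commutator in a suitable permutation
representation with a regular orbit. -/
theorem exists_representation (H : Type*) [Group H] [Countable H] :
    ∃ π : H →* Perm ℕ, (∀ g, π g 0 = 0 → g = 1) ∧ ∃ A : Set (Perm ℕ), A.Countable ∧
      ∀ g, ∃ a ∈ A, ∃ b ∈ A, π g = ⁅a, b⁆ := by
  obtain ⟨_⟩ := nonempty_denumerable (H × ℤ)
  obtain ⟨e, he⟩ : ∃ e : H × ℤ ≃ ℕ, e (1, 0) = 0 :=
    ⟨(Denumerable.eqv (H × ℤ)).trans (swap (Denumerable.eqv (H × ℤ) (1, 0)) 0), by simp⟩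
  let β : Perm (H × ℤ) := (Equiv.refl H).prodCongr (Equiv.addRight 1)
  let f : H → ℤ → H := fun h k => if 0 ≤ k then h else 1
  refine ⟨e.permCongrHom.toMonoidHom.comp
    ((layerHom H).comp (MonoidHom.mulSingle (fun _ : ℤ => H) 0)), fun g hg => ?_,
    insert (e.permCongrHom β) (Set.range fun h => e.permCongrHom (layerHom H (f h))),
    (Set.countable_range _).insert _, fun g => ⟨_, Or.inr ⟨g, rfl⟩, _, Or.inl rfl, ?_⟩⟩
  · have h1 : e (layerHom H (Pi.mulSingle 0 g) (e.symm 0)) = 0 := hg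
    rw [← he, e.symm_apply_apply, e.apply_eq_iff_eq] at h1
    simpa [layerHom] using h1
  · rw [← map_commutatorElement]
    refine congrArg e.permCongrHom ?_
    rw [commutatorElement_def, eq_mul_inv_iff_mul_eq, eq_mul_inv_iff_mul_eq]
    ext ⟨h, k⟩
    · by_cases hk : k + 1 = 0
      · obtain rfl : k = -1 := by omega
        simp [layerHom, β, f]
      · by_cases hk0 : 0 ≤ k
        · simp [layerHom, β, f, hk, hk0, show 0 ≤ k + 1 by omega]
        · simp [layerHom, β, f, hk, hk0, show ¬ 0 ≤ k + 1 by omega]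
    · simp [layerHom, β]

theorem exists_simple_family {J : Type} (K : J → Type) [∀ j, Group (K j)] [∀ j, Countable (K j)]
    (r : J → ℕ) (hr : Function.Injective r) {j₁ : J} (hj₁ : r j₁ ≠ 0) (x : ∀ j, K j)
    (hx : ∀ j, x j ≠ 1) (h3 : ∀ j, r j ≠ 0 → ∃ y h : K j, y ≠ 1 ∧ h ≠ 1 ∧ h ≠ y) :
    ∃ (S : Type) (_ : Group S), IsSimpleGroup S ∧ ∃ Ψ : ∀ j, K j →* S,
      (∀ j, Function.Injective (Ψ j)) ∧
      ∀ i j, r i < r j → ∀ Λ : Subgroup S, Ψ i (x i) ∈ Λ → (∀ g, Ψ j g ∈ Λ) → Λ = ⊤ := by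
  classical
  have : Countable J := hr.countable
  choose π hπ A hA hπA using fun j => exists_representation (K j)
  have hinj : ∀ j, Function.Injective (π j) := fun j => by
    rw [injective_iff_map_eq_one]
    exact fun g hg => hπ j g (by rw [hg]; rfl)
  obtain ⟨s, hs⟩ := (Set.countable_iUnion hA).exists_eq_range
    (Set.nonempty_iUnion.2 ⟨j₁, let ⟨a, ha, _⟩ := hπA j₁ 1; ⟨a, ha⟩⟩)
  let p : ℕ → Perm ℕ := fun n => Nat.casesOn n 1 s
  have hp : ∀ j, ∀ a ∈ A j, ∃ n, n ≠ 0 ∧ p n = a := by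
    intro j a ha
    have : a ∈ Set.range s := hs ▸ Set.mem_iUnion.2 ⟨j, ha⟩
    obtain ⟨n, rfl⟩ := this
    exact ⟨n + 1, by simp, rfl⟩
  obtain ⟨q, hq, hq0⟩ : ∃ q : ℕ → J, (∀ j, q (r j) = j) ∧ ∀ n, n ≠ 0 → r (q n) ≠ 0 := by
    refine ⟨fun n => if h : ∃ j, r j = n then h.choose else j₁, fun j => ?_, fun n hn => ?_⟩
    · have h : ∃ j', r j' = r j := ⟨j, rfl⟩
      beta_reduce
      rw [dif_pos h]
      exact hr h.choose_spec
    · beta_reduce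
      split_ifs with h
      · rwa [h.choose_spec]
      · exact hj₁
  obtain ⟨S, _, hS, Ψ, hΨ, hgen⟩ := exists_simple (p := p) (G := fun n => (π (q n)).range)
    (by
      rintro n _ ⟨g, rfl⟩ h0
      rw [hπ _ g h0, map_one])
    (by
      rintro n _ ⟨g, rfl⟩
      obtain ⟨a, ha, b, hb, e⟩ := hπA _ g
      obtain ⟨k, hk, rfl⟩ := hp _ a ha
      obtain ⟨m, hm, rfl⟩ := hp _ b hb
      rw [e]
      exact Cn_commutator_mem rfl hk hm)
    (x := fun n => ⟨π (q n) (x (q n)), x (q n), rfl⟩)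
    (fun n e => hx (q n) (hinj _ (by rw [map_one]; exact congrArg Subtype.val e)))
    (by
      intro n hn
      obtain ⟨y, h, h1, h2, h3⟩ := h3 (q n) (hq0 n hn.ne')
      exact ⟨_, ⟨y, rfl⟩, _, ⟨h, rfl⟩, fun e => h1 (hinj _ (by rw [e, map_one])),
        fun e => h2 (hinj _ (by rw [e, map_one])), fun e => h3 (hinj _ e)⟩)
  have hmem : ∀ j g, π j g ∈ (π (q (r j))).range := fun j g => by
    rw [hq]
    exact ⟨g, rfl⟩
  refine ⟨S, _, hS, fun j => (Ψ (r j)).comp ((π j).codRestrict _ (hmem j)), fun j => ?_, ?_⟩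
  · exact (hΨ _).comp fun g g' h => hinj j (congrArg Subtype.val h)
  · intro i j hij Λ hi hj
    have hval : ∀ i', i' = i → π i' (x i') = π i (x i) := by
      rintro _ rfl
      rfl
    refine hgen _ _ hij Λ ?_ fun g => ?_
    · rw [show (⟨π (q (r i)) (x (q (r i))), x (q (r i)), rfl⟩ : (π (q (r i))).range) =
        (π i).codRestrict _ (hmem i) (x i) from Subtype.ext (hval _ (hq i))]
      exact hi
    · obtain ⟨g, hg⟩ := g
      have hg' : g ∈ (π j).range := by rwa [hq] at hg
      obtain ⟨k, rfl⟩ := hg'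
      exact hj k

end EmbSimple

open EmbSimple in
/-- Theorem A: for a countable family of countable nontrivial groups (at least two
groups in the family, at least one with at least 3 elements) there is a 2-generated
simple group containing copies of all of them, generated by the copies of `H i` and
`H j` whenever `|H j| ≥ 3` and `i ≠ j`. -/
theorem embedding_family_into_two_generated_simple_group
    (I : Type) [Countable I] [Nontrivial I]
    (H : I → Type) [∀ i, Group (H i)] [∀ i, Countable (H i)] [∀ i, Nontrivial (H i)]
    (h3 : ∃ j, 3 ≤ Cardinal.mk (H j)) :
    ∃ (S : Type) (_ : Group S),
      IsSimpleGroup S ∧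
      (∃ s t : S, Subgroup.closure {s, t} = ⊤) ∧
      ∃ φ : ∀ i, H i →* S,
        (∀ i, Function.Injective (φ i)) ∧
        ∀ i j : I, i ≠ j → 3 ≤ Cardinal.mk (H j) →
          Subgroup.closure ((Set.range (φ i)) ∪ (Set.range (φ j))) = ⊤ := by
  classical
  let B := {i : I // 3 ≤ Cardinal.mk (H i)}
  obtain ⟨f, hf⟩ := exists_injective_nat B
  let K : Option (Option B) → Type
    | none => Multiplicative (ZMod 2)
    | some none => Multiplicative (ZMod 3)
    | some (some i) => H i
  let _ : ∀ j, Group (K j)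
    | none => inferInstanceAs (Group (Multiplicative (ZMod 2)))
    | some none => inferInstanceAs (Group (Multiplicative (ZMod 3)))
    | some (some i) => inferInstanceAs (Group (H i))
  have : ∀ j, Countable (K j)
    | none => inferInstanceAs (Countable (Multiplicative (ZMod 2)))
    | some none => inferInstanceAs (Countable (Multiplicative (ZMod 3)))
    | some (some i) => inferInstanceAs (Countable (H i))
  have : ∀ j, Nontrivial (K j)
    | none => inferInstanceAs (Nontrivial (Multiplicative (ZMod 2)))
    | some none => inferInstanceAs (Nontrivial (Multiplicative (ZMod 3)))
    | some (some i) => inferInstanceAs (Nontrivial (H i))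
  let r : Option (Option B) → ℕ
    | none => 0
    | some none => 1
    | some (some i) => f i + 2
  have hr : Function.Injective r := by
    rintro (_ | _ | i) (_ | _ | j) h <;> simp_all [r]
    exact hf h
  choose x hx using fun j => exists_ne (1 : K j)
  obtain ⟨S, _, hS, Ψ, hΨ, hgen⟩ := exists_simple_family K r hr (j₁ := some none) (by simp [r]) x hx
    (by
      intro j hj
      have hc : 3 ≤ Cardinal.mk (K j) := by
        rcases j with _ | _ | i
        · exact absurd rfl hj
        · change 3 ≤ Cardinal.mk (Multiplicative (ZMod 3))
          simp
        · exact i.2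
      obtain ⟨y, hy, -⟩ := Cardinal.exists_ne_ne_of_three_le hc 1 1
      obtain ⟨h, hh, hhy⟩ := Cardinal.exists_ne_ne_of_three_le hc 1 y
      exact ⟨y, h, hy, hh, hhy⟩)
  refine ⟨S, _, hS, ⟨Ψ none (x none), Ψ (some none) (Multiplicative.ofAdd (1 : ZMod 3)), ?_⟩, ?_⟩
  · refine hgen none (some none) (by simp [r]) _ (Subgroup.subset_closure (by simp)) fun g => ?_
    have hg : ∀ g : Multiplicative (ZMod 3), ∃ k : Fin 3,
        g = Multiplicative.ofAdd (1 : ZMod 3) ^ (k : ℕ) := by decide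
    obtain ⟨k, hk⟩ := hg g
    have hk : g = (Multiplicative.ofAdd (1 : ZMod 3) : K (some none)) ^ (k : ℕ) := hk
    rw [hk, map_pow]
    exact pow_mem (Subgroup.subset_closure (by simp)) _
  · have hφ : ∀ i, ∃ φ : H i →* S, Function.Injective φ ∧
        (∀ h : 3 ≤ Cardinal.mk (H i), ∀ g : K (some (some ⟨i, h⟩)),
          Ψ (some (some ⟨i, h⟩)) g ∈ Set.range φ) ∧
        (¬ 3 ≤ Cardinal.mk (H i) → Ψ none (x none) ∈ Set.range φ) := by
      intro i
      by_cases h : 3 ≤ Cardinal.mk (H i)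
      · exact ⟨Ψ (some (some ⟨i, h⟩)), hΨ _, fun _ g => ⟨g, rfl⟩, fun h' => absurd h h'⟩
      · have hlt := not_le.1 h
        have : Finite (H i) := Cardinal.lt_aleph0_iff_finite.1
          (hlt.trans (Cardinal.natCast_lt_aleph0 (n := 3)))
        have h2 : Nat.card (H i) = 2 := by
          have h1 := Finite.one_lt_card (α := H i)
          rw [← Nat.cast_card] at hlt
          have : Nat.card (H i) < 3 := by exact_mod_cast hlt
          omega
        have := Fact.mk Nat.prime_two
        let e : H i ≃* K none := mulEquivOfPrimeCardEq h2
          (show Nat.card (Multiplicative (ZMod 2)) = 2 by simp)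
        refine ⟨(Ψ none).comp e.toMonoidHom, (hΨ none).comp e.injective, fun h' => absurd h' h,
          fun _ => ⟨e.symm (x none), by simp⟩⟩
    choose φ hφi hφb hφs using hφ
    refine ⟨φ, hφi, fun i j hij hj => ?_⟩
    by_cases hi : 3 ≤ Cardinal.mk (H i)
    · rcases lt_or_gt_of_ne (fun e => hij (congrArg Subtype.val (hf e)) :
        f ⟨i, hi⟩ ≠ f ⟨j, hj⟩) with h | h
      · exact hgen (some (some ⟨i, hi⟩)) (some (some ⟨j, hj⟩)) (by simpa [r] using h) _
          (Subgroup.subset_closure (Or.inl (hφb i hi _)))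
          fun g => Subgroup.subset_closure (Or.inr (hφb j hj g))
      · exact hgen (some (some ⟨j, hj⟩)) (some (some ⟨i, hi⟩)) (by simpa [r] using h) _
          (Subgroup.subset_closure (Or.inr (hφb j hj _)))
          fun g => Subgroup.subset_closure (Or.inl (hφb i hi g))
    · exact hgen none (some (some ⟨j, hj⟩)) (by simp [r]) _
        (Subgroup.subset_closure (Or.inl (hφs i hi)))
        fun g => Subgroup.subset_closure (Or.inr (hφb j hj g))
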